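/- arXiv:math/0309224 — 7 statements merged into one kernel-verified Lean document; each statement's English description precedes it below -/
import Mathlib

section
/- The set of positive integers n for which there exists some k ≥ 1 with T^(k)(n) < n has natural density one. -/
open Filter

/-- The 3x+1 function `T : ℤ → ℤ`. -/
def collatzT (x : ℤ) : ℤ := if x % 2 = 1 then (3 * x + 1) / 2 else x / 2

open scoped Classical

/-- The number of odd terms among the first `k` terms of the `collatzT`-orbit of `x`. -/
def collatzOddCount : ℕ → ℤ → ℕ
  | 0, _ => 0
  | k + 1, x => (if x % 2 = 1 then 1 else 0) + collatzOddCount k (collatzT x)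

lemma collatzOddCount_le (k : ℕ) (x : ℤ) : collatzOddCount k x ≤ k := by
  induction k generalizing x with
  | zero => simp [collatzOddCount]
  | succ k ih =>
    have := ih (collatzT x)
    simp only [collatzOddCount]
    split_ifs <;> omega

lemma two_pow_mul_collatzT_iterate_le (k : ℕ) (x : ℤ) :
    2 ^ k * collatzT^[k] x ≤ 3 ^ collatzOddCount k x * x + 4 ^ k := by
  induction k generalizing x with
  | zero => simp [collatzOddCount]
  | succ k ih =>
    have h := ih (collatzT x)
    have hle : (3 : ℤ) ^ collatzOddCount k (collatzT x) ≤ 4 ^ k :=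
      (pow_le_pow_right₀ (by norm_num) (collatzOddCount_le k _)).trans
        (pow_le_pow_left₀ (by norm_num) (by norm_num) k)
    have hpos : (0 : ℤ) ≤ 4 ^ k := by positivity
    rw [Function.iterate_succ_apply, collatzOddCount, pow_succ, pow_succ, pow_add]
    by_cases hx : x % 2 = 1
    · have hT : 2 * collatzT x = 3 * x + 1 := by simp only [collatzT, if_pos hx]; omega
      simp only [if_pos hx, pow_one]
      linear_combination 2 * h + (3 : ℤ) ^ collatzOddCount k (collatzT x) * hT + hle + hpos
    · have hT : 2 * collatzT x = x := by simp only [collatzT, if_neg hx]; omega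
      simp only [if_neg hx, pow_zero]
      linear_combination 2 * h + (3 : ℤ) ^ collatzOddCount k (collatzT x) * hT + 2 * hpos

lemma collatzT_two_mul_add_of_even (u : ℤ) {v : ℤ} (hv : v % 2 = 0) :
    collatzT (2 * u + v) = u + v / 2 := by
  rw [collatzT, if_neg (by omega)]; omega

lemma collatzT_two_mul_add_of_odd (u : ℤ) {v : ℤ} (hv : v % 2 = 1) :
    collatzT (2 * u + v) = 3 * u + (3 * v + 1) / 2 := by
  rw [collatzT, if_pos (by omega)]; omega

lemma sum_range_two_mul_eq_sum_even_add_sum_odd (f : ℕ → ℝ) (n : ℕ) :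
    ∑ m ∈ Finset.range (2 * n), f m =
      ∑ j ∈ Finset.range n, f (2 * j) + ∑ j ∈ Finset.range n, f (2 * j + 1) := by
  induction n with
  | zero => simp
  | succ n ih =>
    rw [mul_add_one, Finset.sum_range_succ, Finset.sum_range_succ, ih, Finset.sum_range_succ,
      Finset.sum_range_succ]
    ring

/-- The generating function of `collatzOddCount k` over `2 ^ k` consecutive terms of an arithmetic
progression with odd common difference. -/
lemma sum_pow_collatzOddCount (y : ℝ) (k : ℕ) {c : ℤ} (hc : c % 2 = 1) (b : ℤ) :
    ∑ m ∈ Finset.range (2 ^ k), y ^ collatzOddCount k (c * m + b) = (1 + y) ^ k := by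
  induction k generalizing c b with
  | zero => simp [collatzOddCount]
  | succ k ih =>
    have even_part (v : ℤ) (hv : v % 2 = 0) :
        ∑ j ∈ Finset.range (2 ^ k), y ^ collatzOddCount (k + 1) (2 * (c * j) + v) =
          (1 + y) ^ k := by
      rw [← ih hc (v / 2)]
      refine Finset.sum_congr rfl fun j _ => ?_
      rw [collatzOddCount, if_neg (by omega), collatzT_two_mul_add_of_even _ hv, zero_add]
    have odd_part (v : ℤ) (hv : v % 2 = 1) :
        ∑ j ∈ Finset.range (2 ^ k), y ^ collatzOddCount (k + 1) (2 * (c * j) + v) =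
          y * (1 + y) ^ k := by
      rw [← ih (c := 3 * c) (by omega) ((3 * v + 1) / 2), Finset.mul_sum]
      refine Finset.sum_congr rfl fun j _ => ?_
      rw [collatzOddCount, if_pos (by omega), collatzT_two_mul_add_of_odd _ hv, pow_add, pow_one,
        mul_assoc]
    have h_even (j : ℕ) : c * ((2 * j : ℕ) : ℤ) + b = 2 * (c * j) + b := by push_cast; ring
    have h_odd (j : ℕ) : c * ((2 * j + 1 : ℕ) : ℤ) + b = 2 * (c * j) + (c + b) := by
      push_cast; ring
    rw [pow_succ', sum_range_two_mul_eq_sum_even_add_sum_odd]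
    simp only [h_even, h_odd]
    rcases Int.emod_two_eq_zero_or_one b with hb | hb
    · rw [even_part b hb, odd_part (c + b) (by omega)]; ring
    · rw [odd_part b hb, even_part (c + b) (by omega)]; ring

lemma sum_range_mul_pow_collatzOddCount (y : ℝ) (k q : ℕ) :
    ∑ n ∈ Finset.range (2 ^ k * q), y ^ collatzOddCount k n = q * (1 + y) ^ k := by
  induction q with
  | zero => simp
  | succ q ih =>
    have h := sum_pow_collatzOddCount y k (c := 1) (by norm_num) ((2 ^ k * q : ℕ) : ℤ)
    rw [mul_add_one, Finset.sum_range_add, ih, Nat.cast_add_one, add_mul, one_mul, ← h]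
    congr 1
    refine Finset.sum_congr rfl fun m _ => ?_
    rw [one_mul, Nat.cast_add, add_comm]

lemma two_pow_le_three_pow_of_le_collatzT_iterate {k n : ℕ} (hn : 4 ^ k < n)
    (h : (n : ℤ) ≤ collatzT^[k] n) : 2 ^ k ≤ 3 ^ collatzOddCount k n := by
  by_contra! hlt
  have h1 := two_pow_mul_collatzT_iterate_le k n
  have h2 : (3 : ℤ) ^ collatzOddCount k n + 1 ≤ 2 ^ k := by exact_mod_cast hlt
  have h3 : (4 : ℤ) ^ k < n := by exact_mod_cast hn
  have h4 : (2 : ℤ) ^ k * n ≤ 2 ^ k * collatzT^[k] n := by gcongr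
  nlinarith

lemma card_two_pow_le_three_pow_collatzOddCount_le (k q : ℕ) :
    (((Finset.range (2 ^ k * q)).filter
      (fun n : ℕ => 2 ^ k ≤ 3 ^ collatzOddCount k n)).card : ℝ) ≤
        q * ((1 + √3) / √2) ^ k := by
  rw [div_pow, ← mul_div_assoc, ← sum_range_mul_pow_collatzOddCount, Finset.sum_div,
    Finset.card_filter, Nat.cast_sum]
  refine Finset.sum_le_sum fun n _ => ?_
  split_ifs with h
  · rw [Nat.cast_one, one_le_div (by positivity)]
    refine le_of_sq_le_sq ?_ (by positivity)
    rw [pow_right_comm, pow_right_comm √3, Real.sq_sqrt (by norm_num), Real.sq_sqrt (by norm_num)]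
    exact_mod_cast h
  · rw [Nat.cast_zero]; positivity

lemma card_no_descent_le (k N : ℕ) :
    (((Finset.Icc 1 N).filter
      (fun n : ℕ => ¬ ∃ k : ℕ, 1 ≤ k ∧ collatzT^[k] (n : ℤ) < (n : ℤ))).card : ℝ) ≤
        4 ^ (k + 1) + (N / 2 ^ (k + 1) + 1) * ((1 + √3) / √2) ^ (k + 1) := by
  set K := k + 1
  have hsub : (Finset.Icc 1 N).filter
      (fun n : ℕ => ¬ ∃ k : ℕ, 1 ≤ k ∧ collatzT^[k] (n : ℤ) < (n : ℤ)) ⊆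
      Finset.Icc 1 (4 ^ K) ∪ (Finset.range (2 ^ K * (N / 2 ^ K + 1))).filter
        (fun n : ℕ => 2 ^ K ≤ 3 ^ collatzOddCount K n) := by
    intro n hn
    simp only [Finset.mem_filter, Finset.mem_Icc, not_exists, not_and, not_lt] at hn
    obtain ⟨⟨hn1, hnN⟩, hbad⟩ := hn
    simp only [Finset.mem_union, Finset.mem_Icc, Finset.mem_filter, Finset.mem_range]
    rcases le_or_gt n (4 ^ K) with hle | hgt
    · exact Or.inl ⟨hn1, hle⟩
    · exact Or.inr ⟨hnN.trans_lt (Nat.lt_mul_div_succ N (by positivity)),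
        two_pow_le_three_pow_of_le_collatzT_iterate hgt (hbad K (Nat.le_add_left 1 k))⟩
  have hcard := (Finset.card_le_card hsub).trans (Finset.card_union_le _ _)
  rw [Nat.card_Icc, Nat.add_sub_cancel] at hcard
  have hdiv : ((N / 2 ^ K : ℕ) : ℝ) ≤ N / 2 ^ K := by exact_mod_cast Nat.cast_div_le
  have hblocks := card_two_pow_le_three_pow_collatzOddCount_le K (N / 2 ^ K + 1)
  refine (Nat.cast_le (α := ℝ).2 hcard).trans ?_
  push_cast at hblocks ⊢
  gcongr
  refine hblocks.trans ?_
  gcongr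

lemma one_add_sqrt_three_div_lt_one : (1 + √3) / √2 / 2 < 1 := by
  rw [div_div, div_lt_one (by positivity)]
  refine lt_of_pow_lt_pow_left₀ 2 (by positivity) ?_
  have h3 : √3 < 2 := by rw [Real.sqrt_lt' (by norm_num)]; norm_num
  have h3sq : √3 ^ 2 = 3 := Real.sq_sqrt (by norm_num)
  have h2sq : √2 ^ 2 = 2 := Real.sq_sqrt (by norm_num)
  nlinarith

lemma tendsto_card_no_descent_div :
    Tendsto (fun N : ℕ =>
      (((Finset.Icc 1 N).filter
        (fun n : ℕ => ¬ ∃ k : ℕ, 1 ≤ k ∧ collatzT^[k] (n : ℤ) < (n : ℤ))).card : ℝ) / N)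
      atTop (nhds 0) := by
  refine tendsto_order.2 ⟨fun a ha => Eventually.of_forall fun N => ha.trans_le (by positivity),
    fun ε hε => ?_⟩
  obtain ⟨k, hk⟩ := ((tendsto_pow_atTop_nhds_zero_of_lt_one (by positivity)
    one_add_sqrt_three_div_lt_one).comp (tendsto_add_atTop_nat 1)).eventually_lt_const hε |>.exists
  set C : ℝ := 4 ^ (k + 1) + ((1 + √3) / √2) ^ (k + 1)
  have hlim : Tendsto (fun N : ℕ => C / N + ((1 + √3) / √2 / 2) ^ (k + 1)) atTop
      (nhds (0 + ((1 + √3) / √2 / 2) ^ (k + 1))) :=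
    (tendsto_const_div_atTop_nhds_zero_nat C).add_const _
  filter_upwards [hlim.eventually_lt_const (by simpa using hk), eventually_gt_atTop 0]
    with N hN hN0
  refine lt_of_le_of_lt ?_ hN
  have hN0' : (0 : ℝ) < N := by exact_mod_cast hN0
  rw [div_le_iff₀ hN0', div_pow _ 2]
  refine (card_no_descent_le k N).trans_eq ?_
  simp only [C]
  generalize ((1 + √3) / √2) ^ (k + 1) = z
  field_simp
  ring

lemma card_filter_natCast (s : Finset ℕ) (p : ℤ → Prop) :
    ((do let a ← s; pure (a : ℤ) : Finset ℤ).filter p).card =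
      (s.filter (fun n : ℕ => p n)).card := by
  have himage : (do let a ← s; pure (a : ℤ) : Finset ℤ) = s.image (fun n : ℕ => (n : ℤ)) := by
    ext x
    simp [eq_comm]
  rw [himage, Finset.filter_image, Finset.card_image_of_injective _ Nat.cast_injective]

/-- Terras (1976) / Everett (1977): the set of positive integers `n` having some iterate
`T^(k)(n) < n` with `k ≥ 1` has natural density one. -/
theorem terras_everett_density_one :
    Tendsto (fun N : ℕ =>
      (((Finset.Icc 1 N).filter
          (fun n => ∃ k : ℕ, 1 ≤ k ∧ collatzT^[k] (n : ℤ) < (n : ℤ))).card : ℝ) / N)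
      atTop (nhds 1) := by
  have h := tendsto_card_no_descent_div.const_sub 1
  rw [sub_zero] at h
  refine h.congr' ?_
  filter_upwards [eventually_gt_atTop 0] with N hN
  have hN' : (N : ℝ) ≠ 0 := by exact_mod_cast hN.ne'
  have hsum := Finset.card_filter_add_card_filter_not (s := Finset.Icc 1 N)
    (fun n : ℕ => ∃ k : ℕ, 1 ≤ k ∧ collatzT^[k] (n : ℤ) < (n : ℤ))
  rw [Nat.card_Icc, Nat.add_sub_cancel] at hsum
  rw [card_filter_natCast, eq_div_iff hN', sub_mul, div_mul_cancel₀ _ hN', one_mul, sub_eq_iff_eq_add]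
  exact_mod_cast hsum.symm
end

section
/- For any real number β with β > (log 3)/(log 4), the set of positive integers n for which some iterate T^(k)(n) < n^β has natural density one. -/
open Filter

open scoped Classical

/-- The 3x+1 function on natural numbers. -/
def natCollatz (n : ℕ) : ℕ := if n % 2 = 1 then (3 * n + 1) / 2 else n / 2

/-- The number of odd terms among the first `k` terms of the trajectory of `n`. -/
def oddCount : ℕ → ℕ → ℕ
  | 0, _ => 0
  | k + 1, n => n % 2 + oddCount k (natCollatz n)

theorem natCollatz_two_mul (m : ℕ) : natCollatz (2 * m) = m := by
  unfold natCollatz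
  split_ifs <;> omega

theorem natCollatz_two_mul_add_one (m : ℕ) : natCollatz (2 * m + 1) = 3 * m + 2 := by
  unfold natCollatz
  split_ifs <;> omega

theorem collatzT_natCast (n : ℕ) : collatzT n = natCollatz n := by
  unfold collatzT natCollatz
  split_ifs <;> omega

theorem iterate_collatzT_natCast (k n : ℕ) : collatzT^[k] (n : ℤ) = (natCollatz^[k] n : ℕ) :=
  ((Function.Semiconj.iterate_right (f := (Nat.cast : ℕ → ℤ))
    (fun n => (collatzT_natCast n).symm) k) n).symm

theorem two_pow_mul_iterate_natCollatz_le (k n : ℕ) :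
    2 ^ k * natCollatz^[k] n ≤ 3 ^ oddCount k n * (n + 2 ^ k) := by
  induction k generalizing n with
  | zero => simp [oddCount]
  | succ k ih =>
    rw [Function.iterate_succ_apply, oddCount]
    have h := ih (natCollatz n)
    have hk : 1 ≤ 2 ^ k := Nat.one_le_two_pow
    obtain ⟨m, rfl | rfl⟩ := Nat.even_or_odd' n
    · rw [natCollatz_two_mul] at h ⊢
      rw [Nat.mul_mod_right, zero_add, pow_succ]
      linarith
    · rw [natCollatz_two_mul_add_one] at h ⊢
      rw [Nat.mul_add_mod, Nat.mod_eq_of_lt one_lt_two, pow_add 3, pow_succ 2, pow_one]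
      have : 3 ^ oddCount k (3 * m + 2) * (2 * (3 * m + 2 + 2 ^ k)) ≤
          3 ^ oddCount k (3 * m + 2) * (3 * (2 * m + 1 + 2 ^ k * 2)) :=
        Nat.mul_le_mul_left _ (by omega)
      linarith

theorem oddCount_add_two_pow_mul (k n j : ℕ) : oddCount k (n + 2 ^ k * j) = oddCount k n := by
  induction k generalizing n j with
  | zero => rfl
  | succ k ih =>
    obtain ⟨m, rfl | rfl⟩ := Nat.even_or_odd' n
    · have e : 2 * m + 2 ^ (k + 1) * j = 2 * (m + 2 ^ k * j) := by ring
      rw [e, oddCount, oddCount, natCollatz_two_mul, natCollatz_two_mul, ih]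
      simp
    · have e : 2 * m + 1 + 2 ^ (k + 1) * j = 2 * (m + 2 ^ k * j) + 1 := by ring
      have e' : 3 * (m + 2 ^ k * j) + 2 = 3 * m + 2 + 2 ^ k * (3 * j) := by ring
      rw [e, oddCount, oddCount, natCollatz_two_mul_add_one, natCollatz_two_mul_add_one, e', ih]
      simp [Nat.add_mod]

theorem oddCount_mod_two_pow (k n : ℕ) : oddCount k (n % 2 ^ k) = oddCount k n := by
  conv_rhs => rw [← Nat.mod_add_div n (2 ^ k)]
  rw [oddCount_add_two_pow_mul]

theorem sum_range_two_mul {M : Type*} [AddCommMonoid M] (n : ℕ) (f : ℕ → M) :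
    ∑ i ∈ Finset.range (2 * n), f i =
      ∑ i ∈ Finset.range n, (f (2 * i) + f (2 * i + 1)) := by
  induction n with
  | zero => simp
  | succ n ih =>
    rw [Finset.sum_range_succ, ← ih, mul_add, mul_one, Finset.sum_range_succ,
      Finset.sum_range_succ, add_assoc]

theorem sum_range_mod_three_mul_add_two {M : Type*} [AddCommMonoid M] (k : ℕ) (f : ℕ → M) :
    ∑ m ∈ Finset.range (2 ^ k), f ((3 * m + 2) % 2 ^ k) = ∑ m ∈ Finset.range (2 ^ k), f m := by
  have hinj : Set.InjOn (fun m => (3 * m + 2) % 2 ^ k) (Finset.range (2 ^ k)) := by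
    intro a ha b hb hab
    have h3 : 3 * a ≡ 3 * b [MOD 2 ^ k] := Nat.ModEq.add_right_cancel' 2 hab
    have hcop : Nat.gcd (2 ^ k) 3 = 1 := Nat.Coprime.pow_left k (by norm_num)
    have := Nat.ModEq.cancel_left_of_coprime hcop h3
    exact this.eq_of_lt_of_lt (Finset.mem_range.1 ha) (Finset.mem_range.1 hb)
  have himage : (Finset.range (2 ^ k)).image (fun m => (3 * m + 2) % 2 ^ k) =
      Finset.range (2 ^ k) := by
    refine Finset.eq_of_subset_of_card_le ?_ (Finset.card_image_of_injOn hinj).ge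
    intro x hx
    obtain ⟨m, -, rfl⟩ := Finset.mem_image.1 hx
    exact Finset.mem_range.2 (Nat.mod_lt _ (by positivity))
  conv_rhs => rw [← himage]
  rw [Finset.sum_image hinj]

theorem sum_range_two_pow_succ_oddCount {M : Type*} [AddCommMonoid M] (k : ℕ) (f : ℕ → M) :
    ∑ n ∈ Finset.range (2 ^ (k + 1)), f (oddCount (k + 1) n) =
      ∑ n ∈ Finset.range (2 ^ k), (f (oddCount k n) + f (1 + oddCount k n)) := by
  rw [pow_succ', sum_range_two_mul, Finset.sum_add_distrib, Finset.sum_add_distrib]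
  congr 1
  · refine Finset.sum_congr rfl fun m _ => ?_
    rw [oddCount, natCollatz_two_mul, Nat.mul_mod_right, zero_add]
  · rw [← sum_range_mod_three_mul_add_two k fun n => f (1 + oddCount k n)]
    refine Finset.sum_congr rfl fun m _ => ?_
    rw [oddCount, natCollatz_two_mul_add_one, Nat.mul_add_mod, oddCount_mod_two_pow]

theorem sum_sq_two_mul_oddCount_sub (k : ℕ) :
    ∑ n ∈ Finset.range (2 ^ k), (2 * (oddCount k n : ℝ) - k) ^ 2 = (k : ℝ) * 2 ^ k := by
  induction k with
  | zero => simp [oddCount]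
  | succ k ih =>
    rw [sum_range_two_pow_succ_oddCount k fun a : ℕ => (2 * (a : ℝ) - (k + 1 : ℕ)) ^ 2]
    have h (n : ℕ) : (2 * (oddCount k n : ℝ) - (k + 1 : ℕ)) ^ 2 +
        (2 * ((1 + oddCount k n : ℕ) : ℝ) - (k + 1 : ℕ)) ^ 2 =
        2 * (2 * (oddCount k n : ℝ) - k) ^ 2 + 2 := by
      push_cast
      ring
    rw [Finset.sum_congr rfl fun n _ => h n, Finset.sum_add_distrib, ← Finset.mul_sum, ih]
    simp
    ring

theorem sum_range_two_mul_two_pow_sq_two_mul_oddCount_sub (k : ℕ) :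
    ∑ n ∈ Finset.range (2 ^ (k + 1)), (2 * (oddCount k n : ℝ) - k) ^ 2 =
      2 * ((k : ℝ) * 2 ^ k) := by
  have h (n : ℕ) : oddCount k (2 ^ k + n) = oddCount k n := by
    simpa [add_comm] using oddCount_add_two_pow_mul k n 1
  rw [pow_succ, mul_two, Finset.sum_range_add]
  simp_rw [h]
  rw [sum_sq_two_mul_oddCount_sub, two_mul]

/-- Chebyshev's inequality for `oddCount`. -/
theorem card_oddCount_gt_mul_le {δ : ℝ} (hδ : 0 < δ) {k : ℕ} (hk : 0 < k) :
    (((Finset.range (2 ^ (k + 1))).filter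
      (fun n => k * (1 / 2 + δ) < (oddCount k n : ℝ))).card : ℝ) * (2 * δ ^ 2 * k) ≤ 2 ^ k := by
  have hk' : (0 : ℝ) < k := by exact_mod_cast hk
  have h : (((Finset.range (2 ^ (k + 1))).filter
      (fun n => k * (1 / 2 + δ) < (oddCount k n : ℝ))).card : ℝ) * (2 * δ * k) ^ 2 ≤
      2 * (k * 2 ^ k) := by
    rw [← sum_range_two_mul_two_pow_sq_two_mul_oddCount_sub, ← nsmul_eq_mul]
    refine (Finset.card_nsmul_le_sum _ (fun n => (2 * (oddCount k n : ℝ) - k) ^ 2) _ ?_).trans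
      (Finset.sum_le_sum_of_subset_of_nonneg (Finset.filter_subset _ _)
        fun _ _ _ => sq_nonneg _)
    intro n hn
    have := (Finset.mem_filter.1 hn).2
    gcongr
    linarith
  refine le_of_mul_le_mul_right ?_ (mul_pos two_pos hk')
  linarith

theorem iterate_collatzT_lt_rpow {β δ ε : ℝ} (hβ : 0 < β) (hε : 0 < ε) {k n : ℕ}
    (hn : n < 2 ^ (k + 1)) (hεn : ε * 2 ^ k ≤ n) (hodd : (oddCount k n : ℝ) ≤ k * (1 / 2 + δ))
    (hk : Real.log 3 + k * (1 / 2 + δ) * Real.log 3 < β * (Real.log ε + k * Real.log 2)) :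
    ((collatzT^[k] (n : ℤ) : ℤ) : ℝ) < (n : ℝ) ^ β := by
  have hlog3 : 0 < Real.log 3 := Real.log_pos (by norm_num)
  have hbound : natCollatz^[k] n ≤ 3 ^ (oddCount k n + 1) := by
    refine Nat.le_of_mul_le_mul_left (c := 2 ^ k) ?_ (by positivity)
    refine (two_pow_mul_iterate_natCollatz_le k n).trans ?_
    calc 3 ^ oddCount k n * (n + 2 ^ k) ≤ 3 ^ oddCount k n * (3 * 2 ^ k) :=
          Nat.mul_le_mul_left _ (by rw [pow_succ] at hn; omega)
      _ = 2 ^ k * 3 ^ (oddCount k n + 1) := by ring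
  rw [iterate_collatzT_natCast, Int.cast_natCast]
  calc (natCollatz^[k] n : ℝ) ≤ 3 ^ (oddCount k n + 1) := by exact_mod_cast hbound
    _ < (ε * 2 ^ k) ^ β := by
      rw [← Real.log_lt_log_iff (by positivity) (by positivity), Real.log_pow,
        Real.log_rpow (by positivity), Real.log_mul hε.ne' (by positivity), Real.log_pow]
      push_cast
      have := mul_le_mul_of_nonneg_right hodd hlog3.le
      linarith
    _ ≤ (n : ℝ) ^ β := Real.rpow_le_rpow (by positivity) hεn hβ.le

theorem card_filter_bind_pure_natCast (s : Finset ℕ) (p : ℤ → Prop) :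
    (((do let a ← s; pure (a : ℤ)) : Finset ℤ).filter p).card =
      (s.filter (fun n : ℕ => p n)).card := by
  have h : ((do let a ← s; pure (a : ℤ)) : Finset ℤ) = s.image Nat.cast := by
    ext x
    simp [Finset.bind_def, Finset.pure_def, eq_comm]
  rw [h, Finset.filter_image, Finset.card_image_of_injective _ Nat.cast_injective]

theorem eventually_card_not_descending_le {β ε : ℝ} (hβ : Real.log 3 / Real.log 4 < β)
    (hε : 0 < ε) :
    ∀ᶠ N : ℕ in atTop, (((Finset.Icc 1 N).filter
      (fun n : ℕ => ¬ ∃ k : ℕ, ((collatzT^[k] (n : ℤ) : ℤ) : ℝ) < (n : ℝ) ^ β)).card : ℝ) ≤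
        2 * ε * N := by
  have hlog3 : 0 < Real.log 3 := Real.log_pos (by norm_num)
  have hlog2 : 0 < Real.log 2 := Real.log_pos (by norm_num)
  have hlog4 : Real.log 4 = 2 * Real.log 2 := by
    rw [show (4 : ℝ) = 2 ^ 2 by norm_num, Real.log_pow]
    norm_num
  have hβ0 : 0 < β := lt_trans (by rw [hlog4]; positivity) hβ
  rw [hlog4, div_lt_iff₀ (by positivity)] at hβ
  obtain ⟨δ, hδ, hδβ⟩ : ∃ δ : ℝ, 0 < δ ∧ (1 / 2 + δ) * Real.log 3 < β * Real.log 2 := by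
    refine ⟨(β * Real.log 2 - Real.log 3 / 2) / (2 * Real.log 3),
      div_pos (by linarith) (by positivity), ?_⟩
    field_simp
    linarith
  have hlog : Tendsto (fun N => (Nat.log 2 N : ℝ)) atTop atTop :=
    tendsto_natCast_atTop_atTop.comp <|
      tendsto_atTop_atTop.2 fun b => ⟨2 ^ b, fun _ h => Nat.le_log_of_pow_le (by norm_num) h⟩
  filter_upwards [eventually_gt_atTop 0, hlog.eventually_gt_atTop 0,
    hlog.eventually_ge_atTop (1 / (2 * δ ^ 2 * ε)),
    hlog.eventually_gt_atTop ((Real.log 3 - β * Real.log ε) /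
      (β * Real.log 2 - (1 / 2 + δ) * Real.log 3))] with N hN hk0 hkδ hklarge
  set k := Nat.log 2 N
  have hNk : (2 : ℝ) ^ k ≤ N := by exact_mod_cast Nat.pow_log_le_self 2 hN.ne'
  have hNk' : N < 2 ^ (k + 1) := Nat.lt_pow_succ_log_self (by norm_num) N
  rw [div_lt_iff₀ (by linarith)] at hklarge
  rw [div_le_iff₀ (by positivity)] at hkδ
  have hsubset : (Finset.Icc 1 N).filter
      (fun n : ℕ => ¬ ∃ k : ℕ, ((collatzT^[k] (n : ℤ) : ℤ) : ℝ) < (n : ℝ) ^ β) ⊆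
      Finset.Icc 1 ⌊ε * N⌋₊ ∪ (Finset.range (2 ^ (k + 1))).filter
        (fun n => k * (1 / 2 + δ) < (oddCount k n : ℝ)) := by
    intro n hn
    simp only [Finset.mem_filter, Finset.mem_Icc] at hn
    obtain ⟨⟨hn1, hnN⟩, hbad⟩ := hn
    simp only [Finset.mem_union, Finset.mem_filter, Finset.mem_Icc, Finset.mem_range]
    by_contra! hcon
    refine hbad ⟨k, iterate_collatzT_lt_rpow (δ := δ) hβ0 hε (by omega) ?_
      (hcon.2 (by omega)) (by linarith)⟩
    exact (mul_le_mul_of_nonneg_left hNk hε.le).trans (Nat.lt_of_floor_lt (hcon.1 hn1)).le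
  have hcard := (Finset.card_le_card hsubset).trans (Finset.card_union_le _ _)
  rw [Nat.card_Icc, Nat.add_sub_cancel] at hcard
  refine (Nat.cast_le (α := ℝ).2 hcard).trans ?_
  rw [Nat.cast_add]
  have hfloor : (⌊ε * N⌋₊ : ℝ) ≤ ε * N := Nat.floor_le (by positivity)
  have hcheb := card_oddCount_gt_mul_le hδ (k := k) (by exact_mod_cast hk0)
  set B := (((Finset.range (2 ^ (k + 1))).filter
    (fun n => k * (1 / 2 + δ) < (oddCount k n : ℝ))).card : ℝ)
  have hB : B ≤ ε * N := by
    calc B ≤ B * (k * (2 * δ ^ 2 * ε)) := le_mul_of_one_le_right (Nat.cast_nonneg _) hkδ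
      _ = ε * (B * (2 * δ ^ 2 * k)) := by ring
      _ ≤ ε * N := mul_le_mul_of_nonneg_left (hcheb.trans hNk) hε.le
  linarith

/-- Korec (1994): for any real `β > log 3 / log 4`, the set of positive integers `n` having
some iterate `T^(k)(n) < n^β` has natural density one. -/
theorem korec_density_one (β : ℝ) (hβ : Real.log 3 / Real.log 4 < β) :
    Tendsto (fun N : ℕ =>
      (((Finset.Icc 1 N).filter
          (fun n => ∃ k : ℕ, ((collatzT^[k] (n : ℤ) : ℤ) : ℝ) < (n : ℝ) ^ β)).card : ℝ) / N)
      atTop (nhds 1) := by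
  have hN : ∀ᶠ N : ℕ in atTop, (0 : ℝ) < N := by
    filter_upwards [eventually_gt_atTop 0] with N hN
    exact_mod_cast hN
  rw [Metric.tendsto_nhds]
  intro r hr
  have hε : 0 < r / 3 := by positivity
  filter_upwards [hN, eventually_card_not_descending_le hβ hε] with N hN hbad
  have hsplit := Finset.card_filter_add_card_filter_not (s := Finset.Icc 1 N)
    (fun n : ℕ => ∃ k : ℕ, ((collatzT^[k] (n : ℤ) : ℤ) : ℝ) < (n : ℝ) ^ β)
  rw [Nat.card_Icc, Nat.add_sub_cancel] at hsplit
  replace hsplit := congrArg (Nat.cast : ℕ → ℝ) hsplit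
  push_cast at hsplit
  rw [Real.dist_eq, div_sub_one hN.ne', abs_div, abs_of_pos hN, div_lt_iff₀ hN, abs_lt]
  have hrN : 0 < r * N := by positivity
  simp only [card_filter_bind_pure_natCast, Int.cast_natCast]
  constructor
  · linarith
  · have := Nat.cast_nonneg (α := ℝ) ((Finset.Icc 1 N).filter
      (fun n : ℕ => ¬ ∃ k : ℕ, ((collatzT^[k] (n : ℤ) : ℤ) : ℝ) < (n : ℝ) ^ β)).card
    linarith
end

section
/- For every positive integer a with a ≢ 0 (mod 3), there exists x₀ such that for all x ≥ x₀, the number of positive integers n ≤ x having some iterate T^(k)(n) = a (k ≥ 0) is at least x^{3/7}. -/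
open scoped Classical

open Function

theorem collatzT_two_mul (x : ℤ) : collatzT (2 * x) = x := by
  unfold collatzT; split_ifs <;> omega

theorem collatzT_of_three_mul {a b : ℤ} (h : 3 * b = 2 * a - 1) : collatzT b = a := by
  unfold collatzT; split_ifs <;> omega

theorem collatzT_iterate_two_pow_mul (j : ℕ) (x : ℤ) : collatzT^[j] (2 ^ j * x) = x := by
  induction j with
  | zero => simp
  | succ j ih => rw [iterate_succ_apply, pow_succ', mul_assoc, collatzT_two_mul, ih]

/-- The positive integers `n ≤ N` whose trajectory under the `3x+1` function passes through `a`. -/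
noncomputable def collatzTree (a : ℤ) (N : ℕ) : Finset ℕ :=
  (Finset.Icc 1 N).filter (fun n => ∃ k : ℕ, collatzT^[k] (n : ℤ) = a)

theorem mem_collatzTree {a : ℤ} {N n : ℕ} :
    n ∈ collatzTree a N ↔ (1 ≤ n ∧ n ≤ N) ∧ ∃ k : ℕ, collatzT^[k] (n : ℤ) = a := by
  simp [collatzTree]

theorem collatzTree_subset {a b : ℤ} {i : ℕ} (N : ℕ) (h : collatzT^[i] b = a) :
    collatzTree b N ⊆ collatzTree a N := by
  intro n hn
  obtain ⟨hn, k, hk⟩ := mem_collatzTree.1 hn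
  exact mem_collatzTree.2 ⟨hn, i + k, by rw [iterate_add_apply, hk, h]⟩

theorem notMem_periodicPts_of_iterate {α : Type*} {f : α → α} {a b : α} {i : ℕ}
    (ha : a ∉ periodicPts f) (h : f^[i] b = a) : b ∉ periodicPts f := by
  rintro ⟨k, hk, hb⟩
  exact ha ⟨k, hk, h ▸ hb.apply_iterate i⟩

theorem iterate_eq_unique_of_notMem_periodicPts {α : Type*} {f : α → α} {a x : α} {m n : ℕ}
    (ha : a ∉ periodicPts f) (hm : f^[m] x = a) (hn : f^[n] x = a) : m = n := by
  wlog hmn : m ≤ n generalizing m n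
  · exact (this hn hm (by omega)).symm
  by_contra hne
  refine ha (mk_mem_periodicPts (n := n - m) (by omega) ?_)
  rw [IsPeriodicPt, IsFixedPt]
  nth_rw 1 [← hm]
  rw [← iterate_add_apply, Nat.sub_add_cancel hmn, hn]

theorem card_collatzTree_lt {a b : ℤ} {i N : ℕ} (ha : a ∉ periodicPts collatzT) (ha0 : 0 < a)
    (haN : a ≤ N) (hi : 0 < i) (h : collatzT^[i] b = a) :
    (collatzTree b N).card < (collatzTree a N).card := by
  refine Finset.card_lt_card ((Finset.ssubset_iff_of_subset (collatzTree_subset N h)).2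
    ⟨a.toNat, mem_collatzTree.2 ⟨by omega, 0, by simp; omega⟩, fun hmem => ?_⟩)
  obtain ⟨-, k, hk⟩ := mem_collatzTree.1 hmem
  rw [Int.toNat_of_nonneg ha0.le] at hk
  refine ha (mk_mem_periodicPts (n := i + k) (by omega) ?_)
  rw [IsPeriodicPt, IsFixedPt, iterate_add_apply, hk, h]

theorem card_collatzTree_add_le {a b : ℤ} {i : ℕ} (N : ℕ) (ha : a ∉ periodicPts collatzT)
    (ha0 : 0 < a) (hi : i = 1 ∨ i = 2) (h : collatzT^[i] b = a) (hb : b < 2 * a) :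
    (collatzTree (4 * a) N).card + (collatzTree b N).card ≤ (collatzTree a N).card := by
  have h4 : collatzT (4 * a) = 2 * a := by
    rw [show 4 * a = 2 * (2 * a) by ring, collatzT_two_mul]
  have h4a : collatzT^[2] (4 * a) = a := by
    rw [iterate_succ_apply, iterate_one, h4, collatzT_two_mul]
  have hdisj : Disjoint (collatzTree (4 * a) N) (collatzTree b N) := by
    refine Finset.disjoint_left.2 fun n hn hn' => ?_
    obtain ⟨-, k, hk⟩ := mem_collatzTree.1 hn
    obtain ⟨-, l, hl⟩ := mem_collatzTree.1 hn'
    have hkl : 2 + k = i + l := iterate_eq_unique_of_notMem_periodicPts (x := (n : ℤ)) ha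
      (by rw [iterate_add_apply, hk, h4a]) (by rw [iterate_add_apply, hl, h])
    rcases hi with rfl | rfl
    · obtain rfl : l = k + 1 := by omega
      rw [iterate_succ_apply', hk, h4] at hl
      omega
    · obtain rfl : l = k := by omega
      omega
  rw [← Finset.card_union_of_disjoint hdisj]
  exact Finset.card_le_card
    (Finset.union_subset (collatzTree_subset N h4a) (collatzTree_subset N h))

theorem exists_two_pow_mul_notMem_periodicPts {a : ℤ} (ha : 0 < a) :
    ∃ J : ℕ, ∀ j, J ≤ j → 2 ^ j * a ∉ periodicPts collatzT := by
  by_cases hp : a ∈ periodicPts collatzT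
  · obtain ⟨p, hp, hpa⟩ := hp
    set M : ℤ := ∑ i ∈ Finset.range p, |collatzT^[i] a|
    have hM : ∀ i, collatzT^[i] a ≤ M := fun i => by
      rw [← hpa.iterate_mod_apply i]
      exact (le_abs_self _).trans (Finset.single_le_sum
        (f := fun i => |collatzT^[i] a|) (fun _ _ => abs_nonneg _)
        (Finset.mem_range.2 (Nat.mod_lt i hp)))
    refine ⟨M.toNat, fun j hj => ?_⟩
    rintro ⟨k, hk, hper⟩
    have hle : j ≤ k * j := Nat.le_mul_of_pos_left j hk
    have h1 : collatzT^[k * j - j] a = 2 ^ j * a := by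
      nth_rw 1 [← collatzT_iterate_two_pow_mul j a]
      rw [← iterate_add_apply, Nat.sub_add_cancel hle]
      exact hper.mul_const j
    have h2 := hM (k * j - j)
    have h3 : (j : ℤ) < 2 ^ j := by exact_mod_cast Nat.lt_two_pow_self
    have h4 : (2 : ℤ) ^ j ≤ 2 ^ j * a := le_mul_of_one_le_right (by positivity) ha
    omega
  · exact ⟨0, fun j _ => notMem_periodicPts_of_iterate hp (collatzT_iterate_two_pow_mul j a)⟩

/-- Weights of the residue classes modulo `9` in Krasikov's difference inequalities. -/
noncomputable def krasikovWeight (a : ℤ) : ℝ :=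
  if a % 9 = 2 then 1 else if a % 9 = 5 then 0.548 else 0.952

theorem le_krasikovWeight (a : ℤ) : 0.548 ≤ krasikovWeight a := by
  unfold krasikovWeight; split_ifs <;> norm_num

theorem krasikovWeight_le_one (a : ℤ) : krasikovWeight a ≤ 1 := by
  unfold krasikovWeight; split_ifs <;> norm_num

theorem le_rpow_thirteen_div_thirty {q t : ℝ} (ht : 0 ≤ t) (h : q ^ 30 ≤ t ^ 13) :
    q ≤ t ^ (13 / 30 : ℝ) := by
  refine le_of_pow_le_pow_left₀ (n := 30) (by norm_num) (by positivity) (h.trans_eq ?_)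
  rw [← Real.rpow_natCast, ← Real.rpow_natCast, ← Real.rpow_mul ht]
  norm_num

theorem mul_rpow_div_le {q t N a b : ℝ} (ht : 0 ≤ t) (hN : 0 ≤ N) (ha : 0 < a) (hb : 0 < b)
    (hab : t * b ≤ a) (h : q ^ 30 ≤ t ^ 13) :
    q * (N / a) ^ (13 / 30 : ℝ) ≤ (N / b) ^ (13 / 30 : ℝ) := by
  calc q * (N / a) ^ (13 / 30 : ℝ) ≤ t ^ (13 / 30 : ℝ) * (N / a) ^ (13 / 30 : ℝ) := by
        gcongr; exact le_rpow_thirteen_div_thirty ht h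
    _ = (t * (N / a)) ^ (13 / 30 : ℝ) := (Real.mul_rpow ht (by positivity)).symm
    _ ≤ _ := by
        gcongr
        rw [← mul_div_assoc, div_le_div_iff₀ ha hb]
        nlinarith

theorem krasikovWeight_mul_le_card {N : ℕ} {a : ℤ} (ha : a ∉ periodicPts collatzT) (ha0 : 0 < a)
    (ha3 : a % 3 = 2) (haN : a ≤ N) :
    1 / 2 * krasikovWeight a * ((N : ℝ) / a) ^ (13 / 30 : ℝ) ≤ (collatzTree a N).card := by
  induction hm : (collatzTree a N).card using Nat.strong_induction_on generalizing a with
  | _ m ih =>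
  subst hm
  have ih' : ∀ (b : ℤ) (i : ℕ), 0 < i → collatzT^[i] b = a → 0 < b → b % 3 = 2 → b ≤ N →
      1 / 2 * krasikovWeight b * ((N : ℝ) / b) ^ (13 / 30 : ℝ) ≤ (collatzTree b N).card :=
    fun b i hi h hb0 hb3 hbN => ih _ (card_collatzTree_lt ha ha0 haN hi h)
      (notMem_periodicPts_of_iterate ha h) hb0 hb3 hbN rfl
  have haR : (0 : ℝ) < a := by exact_mod_cast ha0
  set F : ℝ := ((N : ℝ) / a) ^ (13 / 30 : ℝ) with hF
  have hF0 : 0 ≤ F := by positivity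
  have hbound : ∀ (b : ℤ) (i : ℕ) (q t : ℝ), 0 < i → collatzT^[i] b = a → 0 < b → b % 3 = 2 →
      b ≤ N → 0 ≤ t → t * b ≤ a → q ^ 30 ≤ t ^ 13 →
      1 / 2 * krasikovWeight b * (q * F) ≤ (collatzTree b N).card := by
    intro b i q t hi h hb0 hb3 hbN ht hab hq
    refine le_trans ?_ (ih' b i hi h hb0 hb3 hbN)
    have hw := le_krasikovWeight b
    have hbR : (0 : ℝ) < b := by exact_mod_cast hb0
    have := mul_rpow_div_le ht N.cast_nonneg haR hbR hab hq
    gcongr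
  by_cases h4N : 4 * a ≤ N
  · have h4a : collatzT^[2] (4 * a) = a := by
      rw [show 4 * a = 2 * (2 * a) by ring, iterate_succ_apply, iterate_one, collatzT_two_mul,
        collatzT_two_mul]
    have hfour := hbound (4 * a) 2 0.548 (1 / 4) (by norm_num) h4a (by omega) (by omega) h4N
      (by norm_num) (by push_cast; linarith) (by norm_num)
    obtain h9 | h9 | h9 : a % 9 = 2 ∨ a % 9 = 5 ∨ a % 9 = 8 := by omega
    · obtain ⟨c, hc⟩ : ∃ c : ℤ, 3 * c = 2 * a - 1 := ⟨(2 * a - 1) / 3, by omega⟩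
      have hi : collatzT^[2] (2 * c) = a := by
        rw [iterate_succ_apply, iterate_one, collatzT_two_mul, collatzT_of_three_mul hc]
      have hcR : (3 : ℝ) * c = 2 * a - 1 := by exact_mod_cast hc
      have hb := hbound (2 * c) 2 0.88 (3 / 4) (by norm_num) hi (by omega) (by omega) (by omega)
        (by norm_num) (by push_cast; linarith) (by norm_num)
      have hadd : ((collatzTree (4 * a) N).card : ℝ) + (collatzTree (2 * c) N).card ≤
          (collatzTree a N).card := by
        exact_mod_cast card_collatzTree_add_le N ha ha0 (Or.inr rfl) hi (by omega)
      have hw := mul_le_mul_of_nonneg_right (le_krasikovWeight (2 * c)) hF0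
      have hwa : krasikovWeight a = 1 := by simp [krasikovWeight, h9]
      have hw4 : krasikovWeight (4 * a) = 0.952 := by
        rw [krasikovWeight, if_neg (by omega), if_neg (by omega)]
      rw [hw4] at hfour
      rw [hwa]
      linarith
    · have hle : ((collatzTree (4 * a) N).card : ℝ) ≤ (collatzTree a N).card := by
        exact_mod_cast Finset.card_le_card (collatzTree_subset N h4a)
      have hwa : krasikovWeight a = 0.548 := by simp [krasikovWeight, h9]
      have hw4 : krasikovWeight (4 * a) = 1 := by
        rw [krasikovWeight, if_pos (by omega)]
      rw [hw4] at hfour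
      rw [hwa]
      linarith
    · obtain ⟨c, hc⟩ : ∃ c : ℤ, 3 * c = 2 * a - 1 := ⟨(2 * a - 1) / 3, by omega⟩
      have hi : collatzT^[1] c = a := collatzT_of_three_mul hc
      have hcR : (3 : ℝ) * c = 2 * a - 1 := by exact_mod_cast hc
      have hb := hbound c 1 1.19 (3 / 2) (by norm_num) hi (by omega) (by omega) (by omega)
        (by norm_num) (by linarith) (by norm_num)
      have hadd : ((collatzTree (4 * a) N).card : ℝ) + (collatzTree c N).card ≤
          (collatzTree a N).card := by
        exact_mod_cast card_collatzTree_add_le N ha ha0 (Or.inl rfl) hi (by omega)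
      have hw := mul_le_mul_of_nonneg_right (le_krasikovWeight c) hF0
      have hwa : krasikovWeight a = 0.952 := by simp [krasikovWeight, h9]
      have hw4 : krasikovWeight (4 * a) = 0.548 := by
        rw [krasikovWeight, if_neg (by omega), if_pos (by omega)]
      rw [hw4] at hfour
      rw [hwa]
      linarith
  · have hone : (1 : ℝ) ≤ (collatzTree a N).card := by
      have : a.toNat ∈ collatzTree a N :=
        mem_collatzTree.2 ⟨by omega, 0, by simp; omega⟩
      exact_mod_cast Finset.card_pos.2 ⟨_, this⟩
    have hNa : (N : ℝ) / 4 ≤ a := by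
      have : (N : ℝ) ≤ 4 * a := by exact_mod_cast (not_le.1 h4N).le
      linarith
    have hF2 : 1 / 2 * F ≤ 1 := by
      have := mul_rpow_div_le (q := 1 / 2) (t := 1 / 4) (N := N) (a := a) (b := N)
        (by norm_num) N.cast_nonneg haR (by exact_mod_cast ha0.trans_le haN) (by linarith)
        (by norm_num)
      rwa [div_self (by exact_mod_cast (ha0.trans_le haN).ne'), Real.one_rpow] at this
    nlinarith [krasikovWeight_le_one a]

theorem exists_collatz_preimage_notMem_periodicPts {a : ℤ} (ha : 0 < a) (ha3 : a % 3 ≠ 0) :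
    ∃ (d : ℤ) (i : ℕ), 0 < d ∧ d % 3 = 2 ∧ d ∉ periodicPts collatzT ∧ collatzT^[i] d = a := by
  obtain ⟨J, hJ⟩ := exists_two_pow_mul_notMem_periodicPts ha
  have hpos : 0 < 2 ^ J * a := by positivity
  have hmod : (2 ^ J * a) % 3 ≠ 0 := fun h => ha3 <| by
    rcases Int.prime_three.dvd_or_dvd (Int.dvd_of_emod_eq_zero h) with h | h
    · exact absurd (Int.prime_three.dvd_of_dvd_pow h) (by norm_num)
    · exact Int.emod_eq_zero_of_dvd h
  by_cases h2 : (2 ^ J * a) % 3 = 2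
  · exact ⟨_, J, hpos, h2, hJ J le_rfl, collatzT_iterate_two_pow_mul J a⟩
  · refine ⟨2 ^ (J + 1) * a, J + 1, by positivity, ?_, hJ _ (by omega),
      collatzT_iterate_two_pow_mul _ a⟩
    rw [pow_succ', mul_assoc]
    omega

/-- Krasikov (1989): for every positive integer `a ≢ 0 (mod 3)`, for all sufficiently large `x`
the number of positive integers `n ≤ x` with some iterate `T^(k)(n) = a` is at least `x^(3/7)`. -/
theorem krasikov_lower_bound (a : ℕ) (ha : 0 < a) (ha3 : a % 3 ≠ 0) :
    ∃ x₀ : ℝ, ∀ x : ℝ, x₀ ≤ x →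
      x ^ ((3 : ℝ) / 7) ≤
        (((Finset.Icc 1 ⌊x⌋₊).filter
            (fun n => ∃ k : ℕ, collatzT^[k] (n : ℤ) = (a : ℤ))).card : ℝ) := by
  obtain ⟨d, i, hd0, hd3, hd, hda⟩ :=
    exists_collatz_preimage_notMem_periodicPts (a := a) (by omega) (by omega)
  have hdR : (0 : ℝ) < d := by exact_mod_cast hd0
  set K : ℝ := 1 / 2 * 0.548 * (1 / (2 * d)) ^ (13 / 30 : ℝ)
  have hK : 0 < K := by positivity
  obtain ⟨x₁, hx₁⟩ := Filter.eventually_atTop.1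
    ((tendsto_rpow_atTop (y := 1 / 210) (by norm_num)).eventually_ge_atTop K⁻¹)
  refine ⟨max x₁ (max 2 d), fun x hx => ?_⟩
  obtain ⟨hxx₁, hx2, hxd⟩ : x₁ ≤ x ∧ 2 ≤ x ∧ (d : ℝ) ≤ x := by simpa using hx
  have hx0 : 0 < x := by linarith
  have hfloor : x / 2 ≤ (⌊x⌋₊ : ℝ) := by linarith [Nat.lt_floor_add_one x]
  have hdN : d ≤ (⌊x⌋₊ : ℤ) := by
    rw [Int.natCast_floor_eq_floor hx0.le]
    exact Int.le_floor.2 hxd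
  calc x ^ ((3 : ℝ) / 7) ≤ K * x ^ (1 / 210 : ℝ) * x ^ ((3 : ℝ) / 7) := by
        refine le_mul_of_one_le_left (by positivity) ?_
        exact (mul_inv_cancel₀ hK.ne').symm.trans_le
          (mul_le_mul_of_nonneg_left (hx₁ x hxx₁) hK.le)
    _ = 1 / 2 * 0.548 * (x / 2 / d) ^ (13 / 30 : ℝ) := by
        rw [mul_assoc, ← Real.rpow_add hx0, show x / 2 / d = 1 / (2 * d) * x by field_simp,
          Real.mul_rpow (by positivity) hx0.le, ← mul_assoc]
        norm_num [K]
    _ ≤ 1 / 2 * krasikovWeight d * ((⌊x⌋₊ : ℝ) / d) ^ (13 / 30 : ℝ) := by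
        have := le_krasikovWeight d
        gcongr
    _ ≤ (collatzTree d ⌊x⌋₊).card := krasikovWeight_mul_le_card hd hd0 hd3 hdN
    _ ≤ _ := by
        refine Nat.cast_le.2 (Finset.card_le_card_of_injOn (fun n : ℕ => (n : ℤ)) (fun n hn => ?_)
          Nat.cast_injective.injOn)
        obtain ⟨hn, hk⟩ := mem_collatzTree.1 (collatzTree_subset ⌊x⌋₊ hda hn)
        simpa [Finset.bind_def, Finset.mem_sup] using And.intro hn hk
end

section
/- For every integer a with a ≢ 0 (mod 3), there exists k₀ such that for all k ≥ k₀, the number n_k(a) of integers n with T^(k)(n) = a satisfies (1.299)^k ≤ n_k(a) ≤ (1.361)^k. -/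
/-- Weights modulo 27 such that the preimages of `a` under `collatzT` have total weight at least
`13 / 10` times the weight of `a`. -/
def lowerWeight (a : ℤ) : ℕ :=
  List.getD
    [0, 73, 95, 0, 55, 54, 0, 43, 72, 0, 71, 90, 0, 66, 56, 0, 41, 102, 0, 69, 93, 0, 78, 53, 0,
      40, 86]
    (a % 27).toNat 0

/-- Weights modulo 81 such that the preimages of `a` under `collatzT` have total weight at most
`34 / 25` times the weight of `a`. -/
def upperWeight (a : ℤ) : ℕ :=
  List.getD
    [1, 1089, 1480, 1, 849, 959, 1, 630, 1154, 1, 1303, 1344, 1, 1230, 856, 1, 610, 1362, 1,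
      982, 1770, 1, 1197, 728, 1, 532, 1672, 1, 1163, 1273, 1, 845, 829, 1, 508, 1008, 1, 1186,
      1334, 1, 1176, 802, 1, 706, 1626, 1, 989, 1530, 1, 1002, 723, 1, 536, 1240, 1, 937, 1581,
      1, 742, 873, 1, 590, 1149, 1, 1126, 1256, 1, 913, 690, 1, 642, 1737, 1, 925, 1612, 1,
      1278, 681, 1, 501, 1598]
    (a % 81).toNat 0

/-- The integers reaching `a` after exactly `k` steps of the 3x+1 function. -/
def iteratePreimage (k : ℕ) (a : ℤ) : Set ℤ := {n | collatzT^[k] n = a}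

theorem collatzT_eq_iff (n b : ℤ) : collatzT n = b ↔ n = 2 * b ∨ 3 * n = 2 * b - 1 := by
  unfold collatzT
  split_ifs <;> omega

theorem iteratePreimage_zero (a : ℤ) : iteratePreimage 0 a = {a} := by
  ext n
  simp [iteratePreimage]

theorem iteratePreimage_succ_of_mod_eq_two (k : ℕ) {a : ℤ} (ha : a % 3 = 2) :
    iteratePreimage (k + 1) a =
      iteratePreimage k (2 * a) ∪ iteratePreimage k ((2 * a - 1) / 3) := by
  ext n
  simp only [iteratePreimage, Set.mem_union, Set.mem_ofPred_eq, Function.iterate_succ_apply',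
    collatzT_eq_iff]
  omega

theorem iteratePreimage_succ_of_mod_ne_two (k : ℕ) {a : ℤ} (ha : a % 3 ≠ 2) :
    iteratePreimage (k + 1) a = iteratePreimage k (2 * a) := by
  ext n
  simp only [iteratePreimage, Set.mem_ofPred_eq, Function.iterate_succ_apply', collatzT_eq_iff]
  omega

theorem iteratePreimage_finite (k : ℕ) (a : ℤ) : (iteratePreimage k a).Finite := by
  induction k generalizing a with
  | zero => simp [iteratePreimage_zero]
  | succ k ih =>
    by_cases ha : a % 3 = 2
    · rw [iteratePreimage_succ_of_mod_eq_two k ha]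
      exact (ih _).union (ih _)
    · rw [iteratePreimage_succ_of_mod_ne_two k ha]
      exact ih _

theorem ncard_iteratePreimage_succ (k : ℕ) (a : ℤ) :
    (iteratePreimage (k + 1) a).ncard = (iteratePreimage k (2 * a)).ncard +
      if a % 3 = 2 then (iteratePreimage k ((2 * a - 1) / 3)).ncard else 0 := by
  split_ifs with ha
  · rw [iteratePreimage_succ_of_mod_eq_two k ha, Set.ncard_union_eq _
      (iteratePreimage_finite _ _) (iteratePreimage_finite _ _)]
    refine Set.disjoint_left.2 fun n h₁ h₂ => ?_
    simp only [iteratePreimage, Set.mem_ofPred_eq] at h₁ h₂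
    omega
  · rw [iteratePreimage_succ_of_mod_ne_two k ha, add_zero]

theorem lowerWeight_congr {a b : ℤ} (h : a % 27 = b % 27) : lowerWeight a = lowerWeight b := by
  simp only [lowerWeight, h]

theorem upperWeight_congr {a b : ℤ} (h : a % 81 = b % 81) : upperWeight a = upperWeight b := by
  simp only [upperWeight, h]

theorem lowerWeight_le (a : ℤ) : lowerWeight a ≤ 102 := by
  have key : ∀ r : Fin 27, lowerWeight (r : ℕ) ≤ 102 := by decide +kernel
  have := key ⟨(a % 27).toNat, by omega⟩
  rwa [lowerWeight_congr (b := a) (by dsimp only; omega)] at this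

theorem one_le_lowerWeight {a : ℤ} (ha : a % 3 ≠ 0) : 1 ≤ lowerWeight a := by
  have key : ∀ r : Fin 27, (r : ℕ) % 3 ≠ 0 → 1 ≤ lowerWeight (r : ℕ) := by decide +kernel
  have := key ⟨(a % 27).toNat, by omega⟩ (by dsimp only; omega)
  rwa [lowerWeight_congr (b := a) (by dsimp only; omega)] at this

theorem one_le_upperWeight (a : ℤ) : 1 ≤ upperWeight a := by
  have key : ∀ r : Fin 81, 1 ≤ upperWeight (r : ℕ) := by decide +kernel
  have := key ⟨(a % 81).toNat, by omega⟩
  rwa [upperWeight_congr (b := a) (by dsimp only; omega)] at this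

theorem lowerWeight_step (a : ℤ) :
    13 * lowerWeight a ≤ 10 * (lowerWeight (2 * a) +
      if a % 3 = 2 then lowerWeight ((2 * a - 1) / 3) else 0) := by
  have key : ∀ r : Fin 81, 13 * lowerWeight (r : ℕ) ≤ 10 * (lowerWeight (2 * (r : ℕ)) +
      if ((r : ℕ) : ℤ) % 3 = 2 then lowerWeight ((2 * (r : ℕ) - 1) / 3) else 0) := by
    decide +kernel
  obtain ⟨r, hr⟩ : ∃ r : Fin 81, ((r : ℕ) : ℤ) = a % 81 :=
    ⟨⟨(a % 81).toNat, by omega⟩, by dsimp only; omega⟩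
  have h := key r
  have hdiv : (2 * (a % 81) - 1) / 3 = (2 * a - 1) / 3 - 54 * (a / 81) := by omega
  rw [hr] at h
  rwa [lowerWeight_congr (a := a % 81) (b := a) (by omega),
    lowerWeight_congr (a := 2 * (a % 81)) (b := 2 * a) (by omega),
    lowerWeight_congr (a := (2 * (a % 81) - 1) / 3) (b := (2 * a - 1) / 3) (by omega),
    show a % 81 % 3 = a % 3 by omega] at h

theorem upperWeight_step (a : ℤ) :
    25 * (upperWeight (2 * a) + if a % 3 = 2 then upperWeight ((2 * a - 1) / 3) else 0) ≤
      34 * upperWeight a := by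
  have key : ∀ r : Fin 243, 25 * (upperWeight (2 * (r : ℕ)) +
      if ((r : ℕ) : ℤ) % 3 = 2 then upperWeight ((2 * (r : ℕ) - 1) / 3) else 0) ≤
      34 * upperWeight (r : ℕ) := by
    decide +kernel
  obtain ⟨r, hr⟩ : ∃ r : Fin 243, ((r : ℕ) : ℤ) = a % 243 :=
    ⟨⟨(a % 243).toNat, by omega⟩, by dsimp only; omega⟩
  have h := key r
  have hdiv : (2 * (a % 243) - 1) / 3 = (2 * a - 1) / 3 - 162 * (a / 243) := by omega
  rw [hr] at h
  rwa [upperWeight_congr (a := a % 243) (b := a) (by omega),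
    upperWeight_congr (a := 2 * (a % 243)) (b := 2 * a) (by omega),
    upperWeight_congr (a := (2 * (a % 243) - 1) / 3) (b := (2 * a - 1) / 3) (by omega),
    show a % 243 % 3 = a % 3 by omega] at h

theorem lowerWeight_mul_pow_le (k : ℕ) (a : ℤ) :
    (lowerWeight a : ℝ) * (13 / 10) ^ k ≤ 102 * ((iteratePreimage k a).ncard : ℝ) := by
  induction k generalizing a with
  | zero =>
    have : (lowerWeight a : ℝ) ≤ 102 := by exact_mod_cast lowerWeight_le a
    simpa [iteratePreimage_zero] using this
  | succ k ih =>
    have step : (13 : ℝ) * lowerWeight a ≤ 10 * (lowerWeight (2 * a) +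
        if a % 3 = 2 then (lowerWeight ((2 * a - 1) / 3) : ℝ) else 0) := by
      exact_mod_cast lowerWeight_step a
    have hpow : (0 : ℝ) ≤ (13 / 10) ^ k := by positivity
    have hmul := mul_le_mul_of_nonneg_right step hpow
    have h₁ := ih (2 * a)
    have h₂ := ih ((2 * a - 1) / 3)
    rw [ncard_iteratePreimage_succ, pow_succ]
    push_cast
    split_ifs at hmul ⊢ <;> linarith

theorem ncard_iteratePreimage_le (k : ℕ) (a : ℤ) :
    ((iteratePreimage k a).ncard : ℝ) ≤ upperWeight a * (34 / 25) ^ k := by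
  induction k generalizing a with
  | zero =>
    have : (1 : ℝ) ≤ upperWeight a := by exact_mod_cast one_le_upperWeight a
    simpa [iteratePreimage_zero] using this
  | succ k ih =>
    have step : 25 * (upperWeight (2 * a) +
        if a % 3 = 2 then (upperWeight ((2 * a - 1) / 3) : ℝ) else 0) ≤
          (34 : ℝ) * upperWeight a := by
      exact_mod_cast upperWeight_step a
    have hpow : (0 : ℝ) ≤ (34 / 25) ^ k := by positivity
    have hmul := mul_le_mul_of_nonneg_right step hpow
    have h₁ := ih (2 * a)
    have h₂ := ih ((2 * a - 1) / 3)
    rw [ncard_iteratePreimage_succ, pow_succ]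
    push_cast
    split_ifs at hmul ⊢ <;> linarith

/-- A geometric sequence eventually dominates any multiple of a slower one. -/
theorem eventually_mul_pow_le_pow (C : ℝ) {x y : ℝ} (hx : 0 < x) (hxy : x < y) :
    ∀ᶠ k : ℕ in Filter.atTop, C * x ^ k ≤ y ^ k := by
  have h := tendsto_pow_atTop_atTop_of_one_lt ((one_lt_div hx).2 hxy)
  filter_upwards [h.eventually_ge_atTop C] with k hk
  rwa [div_pow, le_div_iff₀ (pow_pos hx k)] at hk

/-- Applegate and Lagarias (1995a): for every integer `a ≢ 0 (mod 3)`, for all sufficiently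
large `k` the number `n_k(a)` of integers `n` with `T^(k)(n) = a` satisfies
`(1.299)^k ≤ n_k(a) ≤ (1.361)^k`. -/
theorem applegate_lagarias_tree_bounds (a : ℤ) (ha3 : a % 3 ≠ 0) :
    ∃ k₀ : ℕ, ∀ k : ℕ, k₀ ≤ k →
      ((1.299 : ℝ)) ^ k ≤ ({n : ℤ | collatzT^[k] n = a}.ncard : ℝ) ∧
      ({n : ℤ | collatzT^[k] n = a}.ncard : ℝ) ≤ ((1.361 : ℝ)) ^ k := by
  have hlow := eventually_mul_pow_le_pow 102 (x := 1.299) (y := 13 / 10) (by norm_num) (by norm_num)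
  have hupp := eventually_mul_pow_le_pow (upperWeight a) (x := 34 / 25) (y := 1.361)
    (by norm_num) (by norm_num)
  obtain ⟨k₀, hk₀⟩ := Filter.eventually_atTop.1 (hlow.and hupp)
  refine ⟨k₀, fun k hk => ⟨?_, (ncard_iteratePreimage_le k a).trans (hk₀ k hk).2⟩⟩
  have hw : (1 : ℝ) ≤ lowerWeight a := by exact_mod_cast one_le_lowerWeight ha3
  have h₁ := le_mul_of_one_le_left (by positivity : (0 : ℝ) ≤ (13 / 10) ^ k) hw
  have h₂ : (lowerWeight a : ℝ) * (13 / 10) ^ k ≤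
      102 * ({n : ℤ | collatzT^[k] n = a}.ncard : ℝ) := lowerWeight_mul_pow_le k a
  linarith [(hk₀ k hk).1]
end

section
/- The only solution in positive integers (k, l, h) of the exponential Diophantine equation (2^{k+l} − 3^k)·h = 2^l − 1 is (k, l, h) = (1, 1, 1). -/
section

open Polynomial

theorem dvd_coeff_mul_of_dvd_coeff {a : ℤ} {c d : ℕ} {p q : ℤ[X]}
    (hp : ∀ i, a ^ (c - i) ∣ p.coeff i) (hq : ∀ i, a ^ (d - i) ∣ q.coeff i) (i : ℕ) :
    a ^ (c + d - i) ∣ (p * q).coeff i := by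
  rw [coeff_mul]
  refine Finset.dvd_sum fun x hx => ?_
  rw [Finset.HasAntidiagonal.mem_antidiagonal] at hx
  refine (pow_dvd_pow a ?_).trans ((pow_add a _ _).dvd.trans (mul_dvd_mul (hp x.1) (hq x.2)))
  omega

theorem dvd_coeff_pow_of_dvd_coeff {a : ℤ} {c : ℕ} {p : ℤ[X]}
    (hp : ∀ i, a ^ (c - i) ∣ p.coeff i) (n i : ℕ) :
    a ^ (c * n - i) ∣ (p ^ n).coeff i := by
  induction n generalizing i with
  | zero => simp
  | succ n ih => rw [pow_succ, mul_add_one]; exact dvd_coeff_mul_of_dvd_coeff ih hp i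

theorem abs_coeff_mul_X_sub_C_le {B a : ℤ} {p : ℤ[X]} (ha : 0 ≤ a)
    (hp : ∀ i, |p.coeff i| ≤ B) (i : ℕ) : |(p * (X - C a)).coeff i| ≤ B * (1 + a) := by
  have hB : 0 ≤ B := (abs_nonneg _).trans (hp 0)
  cases i with
  | zero =>
    simp only [mul_sub, coeff_sub, mul_coeff_zero, coeff_X_zero, mul_zero, coeff_C_zero, zero_sub,
      abs_neg, abs_mul, abs_of_nonneg ha]
    nlinarith [hp 0]
  | succ i =>
    rw [coeff_mul_X_sub_C]
    have h := abs_sub (p.coeff i) (p.coeff (i + 1) * a)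
    rw [abs_mul, abs_of_nonneg ha] at h
    nlinarith [hp i, hp (i + 1)]

theorem abs_coeff_mul_X_sub_C_pow_le {B a : ℤ} {p : ℤ[X]} (ha : 0 ≤ a)
    (hp : ∀ i, |p.coeff i| ≤ B) (n i : ℕ) :
    |(p * (X - C a) ^ n).coeff i| ≤ B * (1 + a) ^ n := by
  induction n generalizing i with
  | zero => simpa using hp i
  | succ n ih =>
    rw [pow_succ, pow_succ, ← mul_assoc, ← mul_assoc]
    exact abs_coeff_mul_X_sub_C_le ha ih i

theorem lcmUpto_six_mul_dvd (j : ℕ) :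
    Nat.lcmUpto (6 * j) ∣ Nat.lcmUpto j * ((6 * j).choose (3 * j) * (3 * j).choose j) := by
  rcases Nat.eq_zero_or_pos j with rfl | hj
  · simp [Nat.lcmUpto]
  have hM : (6 * j).choose (3 * j) * (3 * j).choose j ≠ 0 :=
    mul_ne_zero (Nat.choose_pos (by omega)).ne' (Nat.choose_pos (by omega)).ne'
  rw [← Nat.factorization_prime_le_iff_dvd (Nat.lcmUpto_ne_zero _)
    (mul_ne_zero (Nat.lcmUpto_ne_zero _) hM)]
  intro p hp
  rw [Nat.factorization_mul (Nat.lcmUpto_ne_zero _) hM, Finsupp.add_apply,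
    Nat.factorization_lcmUpto _ hp, Nat.factorization_lcmUpto _ hp]
  set M := (6 * j).choose (3 * j) * (3 * j).choose j with hMdef
  have hfac : M * ((3 * j).factorial * ((2 * j).factorial * j.factorial)) = (6 * j).factorial := by
    have h1 := Nat.choose_mul_factorial_mul_factorial (show 3 * j ≤ 6 * j by omega)
    have h2 := Nat.choose_mul_factorial_mul_factorial (show j ≤ 3 * j by omega)
    rw [show 6 * j - 3 * j = 3 * j by omega] at h1
    rw [show 3 * j - j = 2 * j by omega] at h2
    rw [← h1, hMdef]
    linear_combination (6 * j).choose (3 * j) * (3 * j).factorial * h2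
  have hv : (M * ((3 * j).factorial * ((2 * j).factorial * j.factorial))).factorization p =
      (6 * j).factorial.factorization p := by rw [hfac]
  have f1 := (3 * j).factorial_ne_zero
  have f2 := (2 * j).factorial_ne_zero
  have f3 := j.factorial_ne_zero
  set b := p.log (6 * j) + 1 with hb
  have hlog : ∀ i ≤ 6 * j, p.log i < b := fun i hi => Nat.lt_succ_of_le (Nat.log_mono_right hi)
  rw [Nat.factorization_mul hM (by positivity), Nat.factorization_mul f1 (by positivity),
    Nat.factorization_mul f2 f3, Finsupp.add_apply, Finsupp.add_apply, Finsupp.add_apply,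
    Nat.factorization_factorial hp (hlog _ (by omega)),
    Nat.factorization_factorial hp (hlog _ (by omega)),
    Nat.factorization_factorial hp (hlog _ (by omega)),
    Nat.factorization_factorial hp (hlog _ le_rfl)] at hv
  have hind : ∑ i ∈ Finset.Ico 1 b, (if p.log j < i then 1 else 0) = p.log (6 * j) - p.log j := by
    rw [← Finset.card_filter]
    rw [show (Finset.Ico 1 b).filter (fun i => p.log j < i) = Finset.Ico (p.log j + 1) b by
      ext i; simp only [Finset.mem_filter, Finset.mem_Ico]; omega]
    simp [hb]
  have hsum : ∑ i ∈ Finset.Ico 1 b, (if p.log j < i then 1 else 0)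
      + (∑ i ∈ Finset.Ico 1 b, 3 * j / p ^ i +
        (∑ i ∈ Finset.Ico 1 b, 2 * j / p ^ i + ∑ i ∈ Finset.Ico 1 b, j / p ^ i))
      ≤ ∑ i ∈ Finset.Ico 1 b, 6 * j / p ^ i := by
    simp only [← Finset.sum_add_distrib]
    refine Finset.sum_le_sum fun i hi => ?_
    rw [Finset.mem_Ico] at hi
    have hq : 0 < p ^ i := pow_pos hp.pos i
    have hle : p ^ i ≤ 6 * j := Nat.pow_le_of_le_log (by omega) (by omega)
    have a1 := Nat.div_add_div_le_add_div (x := 2 * j) (y := j) (z := p ^ i)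
    have a2 := Nat.div_add_div_le_add_div (x := 3 * j) (y := 3 * j) (z := p ^ i)
    rw [show 2 * j + j = 3 * j by ring] at a1
    rw [show 3 * j + 3 * j = 6 * j by ring] at a2
    split_ifs with h
    · have hlt : j < p ^ i := Nat.lt_pow_of_log_lt hp.one_lt h
      have h0 : j / p ^ i = 0 := Nat.div_eq_of_lt hlt
      have h3 : 3 * j / p ^ i < 3 := (Nat.div_lt_iff_lt_mul hq).2 (by omega)
      have h2 : 2 * j / p ^ i < 2 := (Nat.div_lt_iff_lt_mul hq).2 (by omega)
      have e2 := Nat.le_div_iff_mul_le hq (x := 1) (y := 2 * j)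
      have e3 := Nat.le_div_iff_mul_le hq (x := 1) (y := 3 * j)
      have e3' := Nat.le_div_iff_mul_le hq (x := 2) (y := 3 * j)
      have e6 := Nat.le_div_iff_mul_le hq (x := 1) (y := 6 * j)
      have e6' := Nat.le_div_iff_mul_le hq (x := 2) (y := 6 * j)
      have e6'' := Nat.le_div_iff_mul_le hq (x := 3) (y := 6 * j)
      have e6''' := Nat.le_div_iff_mul_le hq (x := 4) (y := 6 * j)
      omega
    · omega
  have := Nat.log_mono_right (b := p) (show j ≤ 6 * j by omega)
  omega

theorem choose_mul_choose_le (j : ℕ) : (6 * j).choose (3 * j) * (3 * j).choose j ≤ 432 ^ j := by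
  have h1 : (6 * j).choose (3 * j) ≤ 64 ^ j := by
    simpa [pow_mul] using Nat.choose_le_two_pow (6 * j) (3 * j)
  have h2 : (3 * j).choose j * 4 ^ j ≤ 27 ^ j := by
    have h := Finset.single_le_sum (f := fun m => 1 ^ m * 2 ^ (3 * j - m) * (3 * j).choose m)
      (fun _ _ => Nat.zero_le _) (Finset.mem_range.2 (show j < 3 * j + 1 by omega))
    have e := add_pow (1 : ℕ) 2 (3 * j)
    simp only [Nat.cast_id] at e
    rw [← e] at h
    simp only [one_pow, one_mul] at h
    rw [show 3 * j - j = 2 * j by omega, pow_mul, pow_mul] at h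
    norm_num at h
    linarith
  have h3 : (432 : ℕ) ^ j * 4 ^ j = 64 ^ j * 27 ^ j := by simp only [← mul_pow]; norm_num
  refine le_of_mul_le_mul_right ?_ (show 0 < 4 ^ j by positivity)
  calc _ = (6 * j).choose (3 * j) * ((3 * j).choose j * 4 ^ j) := by ring
    _ ≤ 64 ^ j * 27 ^ j := Nat.mul_le_mul h1 h2
    _ = _ := h3.symm

theorem lcmUpto_dvd_lcmUpto {m n : ℕ} (h : m ≤ n) : Nat.lcmUpto m ∣ Nat.lcmUpto n :=
  Finset.lcm_mono (Finset.Icc_subset_Icc_right h)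

theorem lcmUpto_le_pow (n : ℕ) : 5 ^ n * Nat.lcmUpto n ≤ 18 ^ n := by
  induction n using Nat.strong_induction_on with
  | _ n ih =>
    rcases lt_or_ge n 115 with hn | hn
    · have key : ∀ n < 115,
          5 ^ n * (List.range n).foldl (fun a i => Nat.lcm a (i + 1)) 1 ≤ 18 ^ n := by
        decide +kernel
      have hl : ∀ n, Nat.lcmUpto n = (List.range n).foldl (fun a i => Nat.lcm a (i + 1)) 1 := by
        intro n
        induction n with
        | zero => simp [Nat.lcmUpto]
        | succ n ih =>
          rw [List.range_succ, List.foldl_append, ← ih, Nat.lcmUpto, Nat.lcmUpto,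
            ← Finset.insert_Icc_right_eq_Icc_add_one (by omega), Finset.lcm_insert]
          simp [GCDMonoid.lcm, Nat.lcm_comm]
      rw [hl]
      exact key n hn
    · obtain ⟨j, hj1, hj2⟩ : ∃ j, n ≤ 6 * j ∧ 6 * j ≤ n + 5 := ⟨(n + 5) / 6, by omega, by omega⟩
      have h1 : Nat.lcmUpto n ≤ Nat.lcmUpto j * 432 ^ j :=
        calc _ ≤ Nat.lcmUpto (6 * j) :=
              Nat.le_of_dvd (Nat.lcmUpto_pos _) (lcmUpto_dvd_lcmUpto hj1)
          _ ≤ Nat.lcmUpto j * ((6 * j).choose (3 * j) * (3 * j).choose j) :=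
              Nat.le_of_dvd (Nat.mul_pos (Nat.lcmUpto_pos _) (Nat.mul_pos
                (Nat.choose_pos (by omega)) (Nat.choose_pos (by omega)))) (lcmUpto_six_mul_dvd j)
          _ ≤ _ := Nat.mul_le_mul_left _ (choose_mul_choose_le j)
      have h2 := ih j (by omega)
      obtain ⟨t, rfl⟩ : ∃ t, j = t + 20 := ⟨j - 20, by omega⟩
      obtain ⟨r, rfl⟩ : ∃ r, n = 6 * t + 115 + r := ⟨n - (6 * t + 115), by omega⟩
      have hr : (5 : ℕ) ^ r ≤ 18 ^ r := Nat.pow_le_pow_left (by norm_num) r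
      have h3 : 5 ^ (6 * t + 115) * (Nat.lcmUpto (t + 20) * 432 ^ (t + 20)) ≤
          18 ^ (6 * t + 115) := by
        have e1 : 5 ^ (6 * t + 115) * (Nat.lcmUpto (t + 20) * 432 ^ (t + 20))
          = 5 ^ (t + 20) * Nat.lcmUpto (t + 20) * ((5 ^ 5 * 432) ^ t * (5 ^ 95 * 432 ^ 20)) := by
          rw [mul_pow, ← pow_mul]; ring
        have e2 : 18 ^ (6 * t + 115) = 18 ^ (t + 20) * ((18 ^ 5) ^ t * 18 ^ 95) := by
          rw [← pow_mul]; ring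
        rw [e1, e2]
        exact Nat.mul_le_mul h2
          (Nat.mul_le_mul (Nat.pow_le_pow_left (by norm_num) t) (by norm_num))
      calc _ ≤ 5 ^ (6 * t + 115 + r) * (Nat.lcmUpto (t + 20) * 432 ^ (t + 20)) :=
            Nat.mul_le_mul_left _ h1
        _ = 5 ^ (6 * t + 115) * (Nat.lcmUpto (t + 20) * 432 ^ (t + 20)) * 5 ^ r := by ring
        _ ≤ 18 ^ (6 * t + 115) * 18 ^ r := Nat.mul_le_mul h3 hr
        _ = _ := by ring

theorem two_pow_le_three_pow_and_three_pow_add_le {k : ℕ} (hk : 2 ≤ k) (hk' : k < 4800) :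
    ∃ e, 2 ^ e ≤ 3 ^ k ∧ 3 ^ k + 2 ^ (e + 1 - k) ≤ 2 ^ (e + 1) := by
  have key : ∀ a < 80, ∀ b < 60, 2 ≤ 60 * a + b →
      2 ^ ((60 * a + b) * 50508 / 31867) ≤ 3 ^ (60 * a + b) ∧
        3 ^ (60 * a + b) + 2 ^ ((60 * a + b) * 50508 / 31867 + 1 - (60 * a + b)) ≤
          2 ^ ((60 * a + b) * 50508 / 31867 + 1) := by
    decide +kernel
  have h := key (k / 60) (by omega) (k % 60) (by omega)
  rw [Nat.div_add_mod] at h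
  exact ⟨_, h hk⟩

theorem neg_le_on_six_seven {x : ℝ} (h1 : 6 ≤ x) (h2 : x ≤ 7) :
    -(x ^ 5 / 2500) ≤ (x - 6) ^ 6 * (x - 8) ^ 3 * (x - 9) ^ 2 := by
  have key : x ^ 5 + 2500 * ((x - 6) ^ 6 * (x - 8) ^ 3 * (x - 9) ^ 2) =
      7776 * (7 - x) ^ 11 + 92016 * (x - 6) * (7 - x) ^ 10 +
      494640 * (x - 6) ^ 2 * (7 - x) ^ 9 + 1594440 * (x - 6) ^ 3 * (7 - x) ^ 8 +
      3424350 * (x - 6) ^ 4 * (7 - x) ^ 7 + 5145043 * (x - 6) ^ 5 * (7 - x) ^ 6 +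
      5338428 * (x - 6) ^ 6 * (7 - x) ^ 5 + 3715305 * (x - 6) ^ 7 * (7 - x) ^ 4 +
      1688310 * (x - 6) ^ 8 * (7 - x) ^ 3 + 485265 * (x - 6) ^ 9 * (7 - x) ^ 2 +
      82872 * (x - 6) ^ 10 * (7 - x) + 6807 * (x - 6) ^ 11 := by ring
  have h1' : 0 ≤ x - 6 := sub_nonneg.2 h1
  have h2' : 0 ≤ 7 - x := sub_nonneg.2 h2
  have : 0 ≤ x ^ 5 + 2500 * ((x - 6) ^ 6 * (x - 8) ^ 3 * (x - 9) ^ 2) := by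
    rw [key]; positivity
  linarith

theorem neg_le_on_seven_eight {x : ℝ} (h1 : 7 ≤ x) (h2 : x ≤ 8) :
    -(x ^ 5 / 2500) ≤ (x - 6) ^ 6 * (x - 8) ^ 3 * (x - 9) ^ 2 := by
  have key : x ^ 5 + 2500 * ((x - 6) ^ 6 * (x - 8) ^ 3 * (x - 9) ^ 2) =
      6807 * (8 - x) ^ 11 + 66882 * (x - 7) * (8 - x) ^ 10 +
      325365 * (x - 7) ^ 2 * (8 - x) ^ 9 + 1114740 * (x - 7) ^ 3 * (8 - x) ^ 8 +
      2964345 * (x - 7) ^ 4 * (8 - x) ^ 7 + 5867970 * (x - 7) ^ 5 * (8 - x) ^ 6 +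
      8090455 * (x - 7) ^ 6 * (8 - x) ^ 5 + 7415080 * (x - 7) ^ 7 * (8 - x) ^ 4 +
      4370560 * (x - 7) ^ 8 * (8 - x) ^ 3 + 1602560 * (x - 7) ^ 9 * (8 - x) ^ 2 +
      339968 * (x - 7) ^ 10 * (8 - x) + 32768 * (x - 7) ^ 11 := by ring
  have h1' : 0 ≤ x - 7 := sub_nonneg.2 h1
  have h2' : 0 ≤ 8 - x := sub_nonneg.2 h2
  have : 0 ≤ x ^ 5 + 2500 * ((x - 6) ^ 6 * (x - 8) ^ 3 * (x - 9) ^ 2) := by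
    rw [key]; positivity
  linarith

theorem le_on_eight_nine {x : ℝ} (h1 : 8 ≤ x) (h2 : x ≤ 9) :
    (x - 6) ^ 6 * (x - 8) ^ 3 * (x - 9) ^ 2 ≤ x ^ 5 / 2500 := by
  have key : x ^ 5 - 2500 * ((x - 6) ^ 6 * (x - 8) ^ 3 * (x - 9) ^ 2) =
      32768 * (9 - x) ^ 11 + 380928 * (x - 8) * (9 - x) ^ 10 +
      2012160 * (x - 8) ^ 2 * (9 - x) ^ 9 + 6215040 * (x - 8) ^ 3 * (9 - x) ^ 8 +
      12020520 * (x - 8) ^ 4 * (9 - x) ^ 7 + 14487897 * (x - 8) ^ 5 * (9 - x) ^ 6 +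
      10181582 * (x - 8) ^ 6 * (9 - x) ^ 5 + 3655575 * (x - 8) ^ 7 * (9 - x) ^ 4 +
      1041660 * (x - 8) ^ 8 * (9 - x) ^ 3 + 1104435 * (x - 8) ^ 9 * (9 - x) ^ 2 +
      616734 * (x - 8) ^ 10 * (9 - x) + 59049 * (x - 8) ^ 11 := by ring
  have h1' : 0 ≤ x - 8 := sub_nonneg.2 h1
  have h2' : 0 ≤ 9 - x := sub_nonneg.2 h2
  have : 0 ≤ x ^ 5 - 2500 * ((x - 6) ^ 6 * (x - 8) ^ 3 * (x - 9) ^ 2) := by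
    rw [key]; positivity
  linarith

/-- The part without logarithm of the termwise primitive of `p(x) / x ^ (c + 1)`. -/
noncomputable def rationalPrimitive (p : ℤ[X]) (c : ℕ) (x : ℝ) : ℝ :=
  ∑ i ∈ (Finset.range (p.natDegree + 1)).erase c,
    (p.coeff i : ℝ) * (x ^ ((i : ℤ) - c) / ((i : ℤ) - c : ℤ))

theorem hasDerivAt_rationalPrimitive_add_log (p : ℤ[X]) {c : ℕ} (hc : c ≤ p.natDegree) {x : ℝ}
    (hx : 0 < x) :
    HasDerivAt (fun y => rationalPrimitive p c y + p.coeff c * Real.log y)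
      (aeval x p / x ^ (c + 1)) x := by
  have hterm : ∀ i ∈ (Finset.range (p.natDegree + 1)).erase c,
      HasDerivAt (fun y : ℝ => (p.coeff i : ℝ) * (y ^ ((i : ℤ) - c) / ((i : ℤ) - c : ℤ)))
        ((p.coeff i : ℝ) * (x ^ i / x ^ (c + 1))) x := by
    intro i hi
    have hic := Finset.ne_of_mem_erase hi
    have hne : (((i : ℤ) - c : ℤ) : ℝ) ≠ 0 := Int.cast_ne_zero.2 (by omega)
    have h := ((hasDerivAt_zpow ((i : ℤ) - c) x (Or.inl hx.ne')).div_const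
      (((i : ℤ) - c : ℤ) : ℝ)).const_mul (p.coeff i : ℝ)
    refine h.congr_deriv ?_
    rw [mul_div_cancel_left₀ _ hne, sub_sub, zpow_sub₀ hx.ne']
    norm_cast
  have h := (HasDerivAt.fun_sum hterm).add ((Real.hasDerivAt_log hx.ne').const_mul (p.coeff c : ℝ))
  refine h.congr_deriv ?_
  have hlog : (p.coeff c : ℝ) * x⁻¹ = (p.coeff c : ℝ) * (x ^ c / x ^ (c + 1)) := by
    field_simp
    ring
  rw [hlog, Finset.sum_erase_add _ _ (Finset.mem_range.2 (by omega)), aeval_eq_sum_range,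
    Finset.sum_div]
  exact Finset.sum_congr rfl fun i _ => by rw [zsmul_eq_mul, mul_div_assoc]

theorem exists_int_eq_mul_rationalPrimitive {p : ℤ[X]} {b : ℤ} {c N a : ℕ} (ha : 0 < a)
    (hab : (a : ℤ) ∣ b) (hp : ∀ i, b ^ (c - i) ∣ p.coeff i) (hcN : c ≤ N)
    (hdeg : p.natDegree ≤ c + N) :
    ∃ z : ℤ, (Nat.lcmUpto N : ℝ) * rationalPrimitive p c a = z := by
  have ha' : (a : ℝ) ≠ 0 := by positivity
  have hterm : ∀ i ∈ (Finset.range (p.natDegree + 1)).erase c, ∃ z : ℤ,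
      (Nat.lcmUpto N : ℝ) *
        ((p.coeff i : ℝ) * ((a : ℝ) ^ ((i : ℤ) - c) / ((i : ℤ) - c : ℤ))) = z := by
    intro i hi
    rw [Finset.mem_erase, Finset.mem_range] at hi
    obtain ⟨u, hu⟩ : ((i : ℤ) - c) ∣ (Nat.lcmUpto N : ℤ) := by
      have hmem : ((i : ℤ) - c).natAbs ∈ Finset.Icc 1 N := Finset.mem_Icc.2 ⟨by omega, by omega⟩
      rw [← Int.natAbs_dvd, Int.natCast_dvd_natCast]
      exact Finset.dvd_lcm (f := id) hmem
    obtain ⟨w, hw⟩ : ∃ w : ℤ, (p.coeff i : ℝ) * (a : ℝ) ^ ((i : ℤ) - c) = w := by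
      rcases le_total c i with h | h
      · refine ⟨p.coeff i * (a : ℤ) ^ (i - c), ?_⟩
        rw [← Nat.cast_sub h, zpow_natCast]
        push_cast
        rfl
      · obtain ⟨w, hw⟩ := (pow_dvd_pow_of_dvd hab (c - i)).trans (hp i)
        refine ⟨w, ?_⟩
        rw [hw, ← neg_sub, zpow_neg, ← Nat.cast_sub h, zpow_natCast]
        push_cast
        field_simp
    refine ⟨u * w, ?_⟩
    have hne : (((i : ℤ) - c : ℤ) : ℝ) ≠ 0 := Int.cast_ne_zero.2 (by omega)
    have hu' : (Nat.lcmUpto N : ℝ) = (((i : ℤ) - c : ℤ) : ℝ) * u := by exact_mod_cast hu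
    rw [hu', Int.cast_mul, ← hw]
    field_simp
  choose! z hz using hterm
  refine ⟨∑ i ∈ (Finset.range (p.natDegree + 1)).erase c, z i, ?_⟩
  rw [rationalPrimitive, Finset.mul_sum, Int.cast_sum]
  exact Finset.sum_congr rfl hz

/-- The polynomial whose powers give simultaneous rational approximations to `log (4 / 3)` and
`log (9 / 8)`. -/
noncomputable def logPoly : ℤ[X] := (X - C 6) ^ 6 * (X - C 8) ^ 3 * (X - C 9) ^ 2

theorem aeval_logPoly_pow (n : ℕ) (x : ℝ) :
    aeval x (logPoly ^ n) = ((x - 6) ^ 6 * (x - 8) ^ 3 * (x - 9) ^ 2) ^ n := by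
  simp [logPoly, map_ofNat (aeval x)]

theorem natDegree_logPoly_pow (n : ℕ) : (logPoly ^ n).natDegree = 11 * n := by
  have h : ∀ a : ℤ, (X - C a).Monic := monic_X_sub_C
  have h6 := (h 6).pow 6
  have h8 := (h 8).pow 3
  have h9 := (h 9).pow 2
  rw [logPoly, ((h6.mul h8).mul h9).natDegree_pow, (h6.mul h8).natDegree_mul h9,
    h6.natDegree_mul h8, (h 6).natDegree_pow, (h 8).natDegree_pow, (h 9).natDegree_pow]
  simp only [natDegree_X_sub_C]
  ring

theorem dvd_coeff_logPoly_pow (n i : ℕ) : (72 : ℤ) ^ (5 * n - i) ∣ (logPoly ^ n).coeff i := by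
  refine dvd_coeff_pow_of_dvd_coeff (fun i => ?_) n i
  rcases le_or_gt 5 i with h | h
  · simp [Nat.sub_eq_zero_of_le h]
  have hexp : logPoly = C (-1934917632) + C 3090493440 * X + C (-2237621760) * X ^ 2 +
      C 969371712 * X ^ 3 + C (-279173952) * X ^ 4 + C 56118960 * X ^ 5 + C (-8034336) * X ^ 6 +
      C 819180 * X ^ 7 + C (-58292) * X ^ 8 + C 2757 * X ^ 9 + C (-78) * X ^ 10 + X ^ 11 := by
    simp only [logPoly, map_neg, map_ofNat]
    ring
  rw [hexp]
  interval_cases i <;> simp [coeff_X, coeff_X_pow]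

theorem abs_coeff_logPoly_pow_le (n i : ℕ) :
    |(logPoly ^ n).coeff i| ≤ ((1 + 6) ^ 6 * (1 + 8) ^ 3 * (1 + 9) ^ 2) ^ n := by
  induction n generalizing i with
  | zero => rw [pow_zero, pow_zero, coeff_one]; split_ifs <;> simp
  | succ n ih =>
    rw [pow_succ, pow_succ, logPoly, ← mul_assoc, ← mul_assoc, ← mul_assoc, ← mul_assoc,
      ← logPoly]
    exact abs_coeff_mul_X_sub_C_pow_le (by norm_num) (abs_coeff_mul_X_sub_C_pow_le (by norm_num)
      (abs_coeff_mul_X_sub_C_pow_le (by norm_num) ih 6) 3) 2 i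

/-- A primitive of `logPoly ^ n / x ^ (5 * n + 1)` on the positive reals. -/
noncomputable def logPolyPrimitive (n : ℕ) (x : ℝ) : ℝ :=
  rationalPrimitive (logPoly ^ n) (5 * n) x + (logPoly ^ n).coeff (5 * n) * Real.log x

theorem exists_logPolyPrimitive_sub_eq (n : ℕ) {a b : ℝ} (ha : 0 < a) (hab : a < b) :
    ∃ x ∈ Set.Ioo a b, logPolyPrimitive n b - logPolyPrimitive n a =
      (((x - 6) ^ 6 * (x - 8) ^ 3 * (x - 9) ^ 2) / x ^ 5) ^ n / x * (b - a) := by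
  have hd : ∀ x : ℝ, 0 < x → HasDerivAt (logPolyPrimitive n)
      ((((x - 6) ^ 6 * (x - 8) ^ 3 * (x - 9) ^ 2) / x ^ 5) ^ n / x) x := by
    intro x hx
    refine (hasDerivAt_rationalPrimitive_add_log (logPoly ^ n) (c := 5 * n)
      (by rw [natDegree_logPoly_pow]; omega) hx).congr_deriv ?_
    rw [aeval_logPoly_pow, div_pow, div_div, ← pow_mul, ← pow_succ]
  obtain ⟨x, hx, h⟩ := exists_hasDerivAt_eq_slope (logPolyPrimitive n) _ hab
    (fun x hx => (hd x (ha.trans_le hx.1)).continuousAt.continuousWithinAt)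
    (fun x hx => hd x (ha.trans hx.1))
  refine ⟨x, hx, ?_⟩
  rw [h, div_mul_cancel₀ _ (sub_pos.2 hab).ne']

theorem logPolyPrimitive_six_sub_eight_mem {n : ℕ} (hn : Odd n) :
    logPolyPrimitive n 6 - logPolyPrimitive n 8 ∈ Set.Icc 0 (2 / 2500 ^ n : ℝ) := by
  obtain ⟨x, ⟨h6, h8⟩, h⟩ := exists_logPolyPrimitive_sub_eq n (a := 6) (b := 8)
    (by norm_num) (by norm_num)
  have hx : 0 < x := by linarith
  set y := ((x - 6) ^ 6 * (x - 8) ^ 3 * (x - 9) ^ 2) / x ^ 5 with hy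
  have hpos : 0 ≤ -y := by
    have h1 : 0 ≤ (x - 6) ^ 6 * (8 - x) ^ 3 * (x - 9) ^ 2 / x ^ 5 := by
      have : 0 ≤ 8 - x := by linarith
      positivity
    rw [hy]
    convert h1 using 1
    ring
  have hle : -y ≤ 1 / 2500 := by
    have h1 : -(x ^ 5 / 2500) ≤ (x - 6) ^ 6 * (x - 8) ^ 3 * (x - 9) ^ 2 := by
      rcases le_total x 7 with h7 | h7
      · exact neg_le_on_six_seven h6.le h7
      · exact neg_le_on_seven_eight h7 h8.le
    rw [hy, ← neg_div, div_le_iff₀ (by positivity)]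
    linarith
  have hpow := pow_le_pow_left₀ hpos hle n
  rw [one_div_pow] at hpow
  have h0 : 0 ≤ (-y) ^ n := pow_nonneg hpos n
  have hval : logPolyPrimitive n 6 - logPolyPrimitive n 8 = (-y) ^ n / x * 2 := by
    rw [hn.neg_pow]
    linear_combination -h
  rw [hval]
  refine ⟨by positivity, ?_⟩
  have : (-y) ^ n / x ≤ (-y) ^ n := div_le_self h0 (by linarith)
  calc (-y) ^ n / x * 2 ≤ 1 / 2500 ^ n * 2 := by linarith
    _ = 2 / 2500 ^ n := by ring

theorem logPolyPrimitive_sub_nonneg (n : ℕ) {a b : ℝ} (ha : 8 ≤ a) (hab : a < b) :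
    0 ≤ logPolyPrimitive n b - logPolyPrimitive n a := by
  obtain ⟨x, ⟨h1, h2⟩, h⟩ := exists_logPolyPrimitive_sub_eq n (by linarith) hab
  have hx : 0 ≤ x := by linarith
  have hx8 : 0 ≤ x - 8 := by linarith
  have hba : 0 ≤ b - a := by linarith
  rw [h]
  positivity

theorem logPolyPrimitive_nine_sub_eight_le (n : ℕ) :
    logPolyPrimitive n 9 - logPolyPrimitive n 8 ≤ 1 / 2500 ^ n := by
  obtain ⟨x, ⟨h8, h9⟩, h⟩ := exists_logPolyPrimitive_sub_eq n (a := 8) (b := 9)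
    (by norm_num) (by norm_num)
  have hx : 0 < x := by linarith
  have hx8 : 0 ≤ x - 8 := by linarith
  set y := ((x - 6) ^ 6 * (x - 8) ^ 3 * (x - 9) ^ 2) / x ^ 5 with hy
  have hpos : 0 ≤ y := by positivity
  have hle : y ≤ 1 / 2500 := by
    rw [hy, div_le_iff₀ (by positivity)]
    linarith [le_on_eight_nine h8.le h9.le]
  have hpow := pow_le_pow_left₀ hpos hle n
  rw [one_div_pow] at hpow
  have : y ^ n / x ≤ y ^ n := div_le_self (pow_nonneg hpos n) (by linarith)
  linarith

theorem le_logPolyPrimitive_nine_sub_eight (n : ℕ) :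
    1 / (18 * 2 ^ (19 * n)) ≤ logPolyPrimitive n 9 - logPolyPrimitive n 8 := by
  obtain ⟨x, ⟨h1, h2⟩, h⟩ := exists_logPolyPrimitive_sub_eq n (a := 33 / 4) (b := 35 / 4)
    (by norm_num) (by norm_num)
  have hx : 0 < x := by linarith
  have hle : (1 / 2 ^ 19 : ℝ) ≤ ((x - 6) ^ 6 * (x - 8) ^ 3 * (x - 9) ^ 2) / x ^ 5 :=
    calc (1 / 2 ^ 19 : ℝ) ≤ ((9 / 4) ^ 6 * (1 / 4) ^ 3 * (1 / 4) ^ 2) / (35 / 4) ^ 5 := by norm_num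
      _ ≤ ((x - 6) ^ 6 * (x - 8) ^ 3 * (9 - x) ^ 2) / x ^ 5 := by
        have : 0 ≤ x - 8 := by linarith
        gcongr <;> linarith
      _ = _ := by ring
  have hpow := pow_le_pow_left₀ (by positivity) hle n
  rw [one_div_pow, ← pow_mul] at hpow
  have hmid : 1 / (18 * 2 ^ (19 * n)) ≤
      logPolyPrimitive n (35 / 4) - logPolyPrimitive n (33 / 4) := by
    rw [h]
    calc (1 / (18 * 2 ^ (19 * n)) : ℝ) = 1 / 2 ^ (19 * n) / 9 * (35 / 4 - 33 / 4) := by ring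
      _ ≤ _ := by
        have hx9 : x ≤ 9 := by linarith
        gcongr
  have := logPolyPrimitive_sub_nonneg n (a := 8) (b := 33 / 4) le_rfl (by norm_num)
  have := logPolyPrimitive_sub_nonneg n (a := 35 / 4) (b := 9) (by norm_num) (by norm_num)
  linarith

theorem mul_pow_lt_pow {n : ℕ} (hn : 75 ≤ n) : (256 * n + 512) * 2177 ^ n < 2500 ^ n := by
  induction n, hn using Nat.le_induction with
  | base => norm_num
  | succ n hn ih =>
    rw [pow_succ, pow_succ]
    calc (256 * (n + 1) + 512) * (2177 ^ n * 2177)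
        ≤ (256 * n + 512) * 2177 ^ n * 2500 := by
          have : (256 * (n + 1) + 512) * 2177 ≤ (256 * n + 512) * 2500 := by omega
          nlinarith [Nat.zero_le (2177 ^ n)]
      _ < 2500 ^ n * 2500 := by omega

theorem lcmUpto_six_mul_le (n : ℕ) : (Nat.lcmUpto (6 * n) : ℝ) ≤ 2177 ^ n := by
  have h : (5 ^ (6 * n) * Nat.lcmUpto (6 * n) : ℝ) ≤ 18 ^ (6 * n) := by
    exact_mod_cast lcmUpto_le_pow (6 * n)
  rw [← le_div_iff₀' (by positivity), ← div_pow, pow_mul] at h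
  exact h.trans (pow_le_pow_left₀ (by positivity) (by norm_num) n)

/-- The gap `2 ^ (k + l) - 3 ^ k` is at least `2 ^ l` for large `k`. -/
theorem three_pow_add_two_pow_le_of_large {k l : ℕ} (hk : 4800 ≤ k) (h : 3 ^ k < 2 ^ (k + l)) :
    3 ^ k + 2 ^ l ≤ 2 ^ (k + l) := by
  by_contra! hlt
  have hl2 : 2 ^ (k + l) < 2 * 3 ^ k := by
    have : 2 * 2 ^ l ≤ 2 ^ (k + l) := by
      rw [← pow_succ']
      exact Nat.pow_le_pow_right (by norm_num) (by omega)
    omega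
  have hlk : l < k := by
    have h4 : 2 * 3 ^ k ≤ 2 ^ (k + k) := by
      obtain ⟨t, rfl⟩ : ∃ t, k = t + 3 := ⟨k - 3, by omega⟩
      have : 3 ^ t ≤ 4 ^ t := Nat.pow_le_pow_left (by norm_num) t
      rw [← two_mul, pow_mul, pow_succ, pow_add, pow_add]
      norm_num
      omega
    have := (Nat.pow_lt_pow_iff_right (a := 2) (by norm_num)).1 (hl2.trans_le h4)
    omega
  have hkl : k < 2 * l := by
    have h8 : 2 ^ (3 * k) < 2 ^ (2 * (k + l)) :=
      calc 2 ^ (3 * k) = 8 ^ k := by rw [pow_mul]; norm_num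
        _ ≤ 9 ^ k := Nat.pow_le_pow_left (by norm_num) k
        _ = (3 ^ k) ^ 2 := by rw [← pow_mul, mul_comm, pow_mul]; norm_num
        _ < (2 ^ (k + l)) ^ 2 := Nat.pow_lt_pow_left h (by norm_num)
        _ = _ := by rw [← pow_mul, mul_comm]
    have := (Nat.pow_lt_pow_iff_right (a := 2) (by norm_num)).1 h8
    omega
  obtain ⟨n, hn, hn75, hnk, hkn⟩ : ∃ n, Odd n ∧ 75 ≤ n ∧ 64 * n ≤ k ∧ k < 64 * n + 128 :=
    ⟨2 * ((k / 64 - 1) / 2) + 1, ⟨_, rfl⟩, by omega, by omega, by omega⟩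
  have hR : (3 : ℝ) ^ k < 2 ^ (k + l) := by exact_mod_cast h
  have hltR : (2 : ℝ) ^ (k + l) < 3 ^ k + 2 ^ l := by exact_mod_cast hlt
  have hl2R : (2 : ℝ) ^ (k + l) < 2 * 3 ^ k := by exact_mod_cast hl2
  set Λ : ℝ := (k + l) * Real.log 2 - k * Real.log 3 with hΛ
  have hΛlog : Λ = Real.log (2 ^ (k + l) / 3 ^ k) := by
    rw [Real.log_div (by positivity) (by positivity), Real.log_pow, Real.log_pow, hΛ]
    push_cast
    ring
  have hΛ0 : 0 < Λ := by
    rw [hΛlog]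
    exact Real.log_pos ((one_lt_div (by positivity)).2 hR)
  have hΛle : Λ ≤ 2 / 2 ^ (64 * n) :=
    calc Λ ≤ 2 ^ (k + l) / 3 ^ k - 1 := hΛlog ▸ Real.log_le_sub_one_of_pos (by positivity)
      _ ≤ 2 / 2 ^ k := by
        rw [div_sub_one (by positivity), div_le_div_iff₀ (by positivity) (by positivity)]
        calc ((2 : ℝ) ^ (k + l) - 3 ^ k) * 2 ^ k ≤ 2 ^ l * 2 ^ k := by gcongr; linarith
          _ = 2 ^ (k + l) := by ring
          _ ≤ _ := hl2R.le
      _ ≤ 2 / 2 ^ (64 * n) := by gcongr; norm_num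
  set D : ℝ := (Nat.lcmUpto (6 * n) : ℝ) with hD
  have hD0 : 0 < D := Nat.cast_pos.2 (Nat.lcmUpto_pos _)
  have hDle : D ≤ 2177 ^ n := lcmUpto_six_mul_le n
  set q : ℤ := (logPoly ^ n).coeff (5 * n) with hq
  have hqle : |(q : ℝ)| ≤ 2 ^ (33 * n) := by
    have h1 : |(q : ℝ)| ≤ ((1 + 6) ^ 6 * (1 + 8) ^ 3 * (1 + 9) ^ 2) ^ n := by
      exact_mod_cast abs_coeff_logPoly_pow_le n (5 * n)
    rw [pow_mul]
    exact h1.trans (pow_le_pow_left₀ (by positivity) (by norm_num) n)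
  have hint : ∀ a : ℕ, 0 < a → (a : ℤ) ∣ 72 → ∃ z : ℤ,
      D * rationalPrimitive (logPoly ^ n) (5 * n) a = z := fun a ha h72 =>
    exists_int_eq_mul_rationalPrimitive ha h72 (dvd_coeff_logPoly_pow n) (by omega)
      (by rw [natDegree_logPoly_pow]; omega)
  obtain ⟨z6, hz6⟩ := hint 6 (by norm_num) (by norm_num)
  obtain ⟨z8, hz8⟩ := hint 8 (by norm_num) (by norm_num)
  obtain ⟨z9, hz9⟩ := hint 9 (by norm_num) (by norm_num)
  push_cast at hz6 hz8 hz9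
  have hlog6 : Real.log 6 = Real.log 2 + Real.log 3 := by
    rw [← Real.log_mul (by norm_num) (by norm_num)]; norm_num
  have hlog8 : Real.log 8 = 3 * Real.log 2 := by
    rw [show (8 : ℝ) = 2 ^ 3 by norm_num, Real.log_pow]; norm_num
  have hlog9 : Real.log 9 = 2 * Real.log 3 := by
    rw [show (9 : ℝ) = 3 ^ 2 by norm_num, Real.log_pow]; norm_num
  set Φ : ℝ := (2 * l - k) * (logPolyPrimitive n 6 - logPolyPrimitive n 8) +
    (k - l) * (logPolyPrimitive n 9 - logPolyPrimitive n 8) with hΦ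
  have hid : D * Φ + D * (q * Λ) =
      (((2 * l - k) * (z6 - z8) + (k - l) * (z9 - z8) : ℤ) : ℝ) := by
    push_cast
    rw [hΦ, hΛ, ← hz6, ← hz8, ← hz9]
    simp only [logPolyPrimitive, ← hq, hlog6, hlog8, hlog9]
    ring
  obtain ⟨h68, h68'⟩ := logPolyPrimitive_six_sub_eight_mem hn
  have h98 := le_logPolyPrimitive_nine_sub_eight n
  have h98' := logPolyPrimitive_nine_sub_eight_le n
  have hlkR : (l : ℝ) + 1 ≤ k := by exact_mod_cast hlk
  have hklR : (k : ℝ) ≤ 2 * l := by exact_mod_cast hkl.le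
  have hΦge : 1 / (18 * 2 ^ (19 * n)) ≤ Φ := by
    have h1 : 0 ≤ (2 * l - k : ℝ) * (logPolyPrimitive n 6 - logPolyPrimitive n 8) :=
      mul_nonneg (by linarith) h68
    have h2 : (0 : ℝ) < 1 / (18 * 2 ^ (19 * n)) := by positivity
    nlinarith
  have hΦpos : 0 < Φ := lt_of_lt_of_le (by positivity) hΦge
  have hΦle : Φ ≤ 2 * k / 2500 ^ n :=
    calc Φ ≤ (2 * l - k) * (2 / 2500 ^ n) + (k - l) * (1 / 2500 ^ n) :=
          add_le_add (mul_le_mul_of_nonneg_left h68' (by linarith))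
            (mul_le_mul_of_nonneg_left h98' (by linarith))
      _ = (3 * l - k) / 2500 ^ n := by ring
      _ ≤ _ := by gcongr; linarith
  have hDΦ : D * Φ < 1 / 2 := by
    have hk' : (k : ℝ) ≤ 64 * n + 128 := by exact_mod_cast hkn.le
    have h1 : ((256 * n + 512) * 2177 ^ n : ℝ) < 2500 ^ n := by exact_mod_cast mul_pow_lt_pow hn75
    calc D * Φ ≤ 2177 ^ n * (2 * (64 * n + 128) / 2500 ^ n) := by
          refine mul_le_mul hDle (hΦle.trans ?_) hΦpos.le (by positivity)
          gcongr
      _ = (256 * n + 512) * 2177 ^ n / 2500 ^ n / 2 := by ring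
      _ < 1 / 2 := by
        have := (div_lt_one (by positivity : (0 : ℝ) < 2500 ^ n)).2 h1
        linarith
  have hqΛ : |q * Λ| ≤ 2 / 2 ^ (31 * n) := by
    rw [abs_mul, abs_of_pos hΛ0]
    calc |(q : ℝ)| * Λ ≤ 2 ^ (33 * n) * (2 / 2 ^ (64 * n)) := by gcongr
      _ = 2 / 2 ^ (31 * n) := by
        rw [show 64 * n = 33 * n + 31 * n by ring, pow_add]
        field_simp
  have hsmall : ∀ t : ℕ, 10 ≤ t * n → (2 : ℝ) / 2 ^ (t * n) ≤ 1 / 512 := fun t ht =>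
    calc (2 : ℝ) / 2 ^ (t * n) ≤ 2 / 2 ^ 10 := by gcongr; norm_num
      _ = 1 / 512 := by norm_num
  have hDqΛ : |D * (q * Λ)| < 1 / 2 := by
    rw [abs_mul, abs_of_pos hD0]
    calc D * |q * Λ| ≤ 2 ^ (12 * n) * (2 / 2 ^ (31 * n)) := by
          refine mul_le_mul (hDle.trans ?_) hqΛ (abs_nonneg _) (by positivity)
          rw [pow_mul]
          exact pow_le_pow_left₀ (by norm_num) (by norm_num) n
      _ = 2 / 2 ^ (19 * n) := by
        rw [show 31 * n = 12 * n + 19 * n by ring, pow_add]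
        field_simp
      _ < 1 / 2 := (hsmall 19 (by omega)).trans_lt (by norm_num)
  have hDΦpos : 0 < D * Φ := mul_pos hD0 hΦpos
  rw [abs_lt] at hDqΛ
  have hzero : ((2 * l - k) * (z6 - z8) + (k - l) * (z9 - z8) : ℤ) = 0 := by
    rw [← Int.abs_lt_one_iff, ← Int.cast_lt (R := ℝ), Int.cast_abs, ← hid, abs_lt]
    push_cast
    constructor <;> linarith
  rw [hzero, Int.cast_zero, ← mul_add] at hid
  have hΦeq : Φ = -(q * Λ) := by
    have := (mul_eq_zero.1 hid).resolve_left hD0.ne'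
    linarith
  have hΦle' : Φ ≤ 2 / 2 ^ (31 * n) := by
    rw [hΦeq]
    exact (neg_le_abs _).trans hqΛ
  have hcontr : (2 : ℝ) / 2 ^ (31 * n) < 1 / (18 * 2 ^ (19 * n)) := by
    have h1 := hsmall 12 (by omega)
    rw [show 31 * n = 12 * n + 19 * n by ring, pow_add, ← div_div, ← div_div]
    exact div_lt_div_of_pos_right (h1.trans_lt (by norm_num)) (by positivity)
  linarith

theorem three_pow_add_two_pow_le {k l : ℕ} (hk : 2 ≤ k) (h : 3 ^ k < 2 ^ (k + l)) :
    3 ^ k + 2 ^ l ≤ 2 ^ (k + l) := by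
  rcases lt_or_ge k 4800 with hk' | hk'
  · obtain ⟨e, he, he'⟩ := two_pow_le_three_pow_and_three_pow_add_le hk hk'
    have hlt : e < k + l := (Nat.pow_lt_pow_iff_right (a := 2) (by norm_num)).1 (he.trans_lt h)
    rcases (Nat.succ_le_of_lt hlt).eq_or_lt with heq | hgt
    · rw [Nat.succ_eq_add_one] at heq
      rwa [heq, Nat.add_sub_cancel_left] at he'
    · have h1 : 2 ^ (e + 1) * 2 ≤ 2 ^ (k + l) := by
        rw [← pow_succ]
        exact Nat.pow_le_pow_right (by norm_num) hgt
      have h2 : 2 ^ l * 2 ≤ 2 ^ (k + l) := by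
        rw [← pow_succ]
        exact Nat.pow_le_pow_right (by norm_num) (by omega)
      have h3 : 3 ^ k ≤ 2 ^ (e + 1) := (Nat.le_add_right _ _).trans he'
      omega
  · exact three_pow_add_two_pow_le_of_large hk' h

end

/-- Steiner (1978): the only solution in positive integers `(k, l, h)` of
`(2^(k+l) − 3^k)·h = 2^l − 1` is `(1, 1, 1)`. -/
theorem steiner_circuit_equation (k l h : ℕ) (hk : 0 < k) (hl : 0 < l) (hh : 0 < h)
    (heq : ((2 : ℤ) ^ (k + l) - 3 ^ k) * (h : ℤ) = 2 ^ l - 1) :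
    k = 1 ∧ l = 1 ∧ h = 1 := by
  have hpow : (1 : ℤ) < 2 ^ l := one_lt_pow₀ (by norm_num) hl.ne'
  have hh' : (1 : ℤ) ≤ h := by exact_mod_cast hh
  have hpos : (0 : ℤ) < 2 ^ (k + l) - 3 ^ k := by
    by_contra! hneg
    nlinarith
  have hlt : (2 : ℤ) ^ (k + l) < 3 ^ k + 2 ^ l := by nlinarith
  rcases (Nat.succ_le_of_lt hk).eq_or_lt with hk1 | hk2
  · obtain rfl : k = 1 := hk1.symm
    have hl1 : l = 1 := by
      by_contra hne
      have : (2 : ℤ) ^ 2 ≤ 2 ^ l := pow_le_pow_right₀ (by norm_num) (by omega)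
      rw [pow_add] at hlt
      linarith
    subst hl1
    norm_num at heq
    exact ⟨rfl, rfl, heq⟩
  · have h1 : 3 ^ k < 2 ^ (k + l) := by exact_mod_cast sub_pos.1 hpos
    have h2 : (3 : ℤ) ^ k + 2 ^ l ≤ 2 ^ (k + l) := by
      exact_mod_cast three_pow_add_two_pow_le hk2 h1
    linarith
end

section
/- If x is an integer lying on a cycle of the 3x+1 function T of period n ≥ 1 (that is, T^(n)(x) = x), then |x| < 3^n. -/
lemma two_mul_collatzT (y : ℤ) : 2 * collatzT y = y ∨ 2 * collatzT y = 3 * y + 1 := by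
  unfold collatzT
  split_ifs <;> omega

lemma exists_two_pow_mul_collatzT_iterate (x : ℤ) (n : ℕ) :
    ∃ (k : ℕ) (c : ℤ), 2 ^ n * collatzT^[n] x = 3 ^ k * x + c ∧ 0 ≤ c ∧ c ≤ 3 ^ n - 2 ^ n := by
  induction n with
  | zero => exact ⟨0, 0, by simp⟩
  | succ n ih =>
    obtain ⟨k, c, h, hc, hcn⟩ := ih
    have h2 : (0 : ℤ) < 2 ^ n := by positivity
    have h3 : (0 : ℤ) < 3 ^ n := by positivity
    rw [Function.iterate_succ_apply']
    rcases two_mul_collatzT (collatzT^[n] x) with hT | hT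
    · refine ⟨k, c, ?_, hc, ?_⟩
      · rw [pow_succ, mul_assoc, hT, h]
      · rw [pow_succ, pow_succ]
        linarith
    · refine ⟨k + 1, 3 * c + 2 ^ n, ?_, by positivity, ?_⟩
      · rw [pow_succ, mul_assoc, hT]
        linear_combination 3 * h
      · rw [pow_succ, pow_succ]
        linarith

/-- Böhm and Sontacchi (1978): an integer `x` lying on a cycle of period `n ≥ 1` of the
3x+1 function satisfies `|x| < 3^n`. -/
theorem boehm_sontacchi (x : ℤ) (n : ℕ) (hn : 1 ≤ n) (hx : collatzT^[n] x = x) :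
    |x| < 3 ^ n := by
  obtain ⟨k, c, h, hc, hcn⟩ := exists_two_pow_mul_collatzT_iterate x n
  rw [hx] at h
  have hne : (2 ^ n - 3 ^ k : ℤ) ≠ 0 := by
    intro h0
    have heven : Even ((2 : ℤ) ^ n) := even_two.pow_of_ne_zero (by omega)
    have hodd : Odd ((3 : ℤ) ^ k) := Odd.pow (by decide)
    rw [sub_eq_zero.mp h0] at heven
    exact Int.not_even_iff_odd.mpr hodd heven
  have habs : |(2 ^ n - 3 ^ k : ℤ)| * |x| = c := by
    have hmul : (2 ^ n - 3 ^ k) * x = c := by linear_combination h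
    rw [← abs_mul, hmul, abs_of_nonneg hc]
  have hle : |x| ≤ c :=
    habs ▸ le_mul_of_one_le_left (abs_nonneg x) (Int.one_le_abs hne)
  have h2 : (0 : ℤ) < 2 ^ n := by positivity
  linarith
end

section
/- The map Q_∞ : ℤ₂ → ℤ₂ defined by Q_∞(α) = Σ_{i=0}^∞ a_i 2^i, where a_i ∈ {0,1} and a_i ≡ T^(i)(α) (mod 2), is a homeomorphism of the 2-adic integers onto themselves which preserves the normalized Haar measure on ℤ₂. -/
open MeasureTheory

open scoped Classical

/-- "Divide by 2" on the 2-adic integers, defined (via choice) on multiples of 2. -/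
noncomputable def padicHalf (x : ℤ_[2]) : ℤ_[2] :=
  if h : ∃ c : ℤ_[2], x = 2 * c then h.choose else 0

/-- The 3x+1 function extended to the 2-adic integers:
`T(α) = (3α+1)/2` if `α ≡ 1 (mod 2)` and `T(α) = α/2` if `α ≡ 0 (mod 2)`. -/
noncomputable def padicT (α : ℤ_[2]) : ℤ_[2] :=
  if (2 : ℤ_[2]) ∣ α then padicHalf α else padicHalf (3 * α + 1)

/-- The map `Q_∞(α) = Σ_{i≥0} a_i 2^i` where `a_i ∈ {0,1}` and `a_i ≡ T^(i)(α) (mod 2)`. -/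
noncomputable def Qinf (α : ℤ_[2]) : ℤ_[2] :=
  ∑' i : ℕ, (if (2 : ℤ_[2]) ∣ padicT^[i] α then 0 else 1) * 2 ^ i

/-- An isometry of a compact metric space into itself is onto. -/
theorem Isometry.surjective_of_compactSpace {X : Type*} [MetricSpace X] [CompactSpace X]
    {f : X → X} (hf : Isometry f) : Function.Surjective f := by
  intro y
  by_contra hy
  have hclosed : IsClosed (Set.range f) := (isCompact_range hf.continuous).isClosed
  obtain ⟨ε, hε, hball⟩ := Metric.isOpen_iff.1 hclosed.isOpen_compl y hy
  have hfar (z : X) : ε ≤ dist (f z) y := by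
    by_contra! hz
    exact hball hz ⟨z, rfl⟩
  have hiter (m : ℕ) : Isometry f^[m] := by
    induction m with
    | zero => exact isometry_id
    | succ m ih => exact ih.comp hf
  have hsep {m n : ℕ} (hmn : m < n) : ε ≤ dist (f^[n] y) (f^[m] y) := by
    obtain ⟨k, rfl⟩ := Nat.exists_eq_add_of_lt hmn
    rw [add_assoc, Function.iterate_add_apply, (hiter m).dist_eq,
      Function.iterate_succ_apply']
    exact hfar _
  obtain ⟨a, φ, hφ, ha⟩ := CompactSpace.tendsto_subseq fun n => f^[n] y
  obtain ⟨N, hN⟩ := Metric.cauchySeq_iff.1 ha.cauchySeq ε hε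
  exact (hN (N + 1) N.le_succ N le_rfl).not_ge (hsep (hφ N.lt_succ_self))

/-- In a second countable ultrametric space, an isometric bijection preserves any finite measure
for which balls of equal radius have equal mass. -/
theorem IsometryEquiv.measurePreserving_of_measure_ball_eq {X : Type*} [MetricSpace X]
    [IsUltrametricDist X] [SecondCountableTopology X] [MeasurableSpace X] [BorelSpace X]
    {μ : Measure X} [IsFiniteMeasure μ]
    (hμ : ∀ x y r, μ (Metric.ball x r) = μ (Metric.ball y r)) (e : X ≃ᵢ X) :
    MeasurePreserving e μ μ := by
  have hmeas : Measurable e := e.continuous.measurable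
  let C : Set (Set X) := {s | ∃ x r, s = Metric.ball x r}
  have hbasis : TopologicalSpace.IsTopologicalBasis C := by
    refine TopologicalSpace.isTopologicalBasis_of_isOpen_of_nhds ?_ ?_
    · rintro _ ⟨x, r, rfl⟩
      exact Metric.isOpen_ball
    · intro x u hx hu
      obtain ⟨ε, hε, h⟩ := Metric.isOpen_iff.1 hu x hx
      exact ⟨_, ⟨x, ε, rfl⟩, Metric.mem_ball_self hε, h⟩
  refine ⟨hmeas, ext_of_generate_finite C ?_ ?_ ?_ ?_⟩
  · rw [‹BorelSpace X›.measurable_eq, hbasis.borel_eq_generateFrom]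
  · rintro _ ⟨x, r, rfl⟩ _ ⟨y, s, rfl⟩ hne
    rcases IsUltrametricDist.ball_subset_trichotomy x y r s with h | h | h
    · exact ⟨x, r, Set.inter_eq_left.2 h⟩
    · exact ⟨y, s, Set.inter_eq_right.2 h⟩
    · exact absurd h (Set.not_disjoint_iff_nonempty_inter.2 hne)
  · rintro _ ⟨x, r, rfl⟩
    rw [Measure.map_apply hmeas Metric.isOpen_ball.measurableSet, e.preimage_ball]
    exact hμ _ _ _
  · rw [Measure.map_apply hmeas .univ, Set.preimage_univ]

theorem PadicInt.norm_le_of_forall_pow_dvd {p : ℕ} [Fact p.Prime] {x y : ℤ_[p]}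
    (h : ∀ n : ℕ, (p : ℤ_[p]) ^ n ∣ x → (p : ℤ_[p]) ^ n ∣ y) : ‖y‖ ≤ ‖x‖ := by
  have hval {z : ℤ_[p]} (hz : z ≠ 0) (n : ℕ) : (p : ℤ_[p]) ^ n ∣ z ↔ n ≤ z.valuation := by
    rw [← PadicInt.mem_span_pow_iff_le_valuation z hz, Ideal.mem_span_singleton]
  rcases eq_or_ne y 0 with rfl | hy
  · simp
  have hx : x ≠ 0 := by
    rintro rfl
    have := (hval hy _).1 (h (y.valuation + 1) (dvd_zero _))
    omega
  rw [PadicInt.norm_eq_zpow_neg_valuation hx, PadicInt.norm_le_pow_iff_le_valuation y hy,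
    ← hval hy]
  exact h _ ((hval hx _).2 le_rfl)

theorem PadicInt.two_dvd_sub_one {α : ℤ_[2]} (h : ¬ (2 : ℤ_[2]) ∣ α) : (2 : ℤ_[2]) ∣ α - 1 := by
  obtain ⟨n, hn, hmem⟩ := PadicInt.exists_mem_range (p := 2) α
  rw [PadicInt.maximalIdeal_eq_span_p, Ideal.mem_span_singleton] at hmem
  interval_cases n
  · exact absurd (by simpa using hmem) h
  · simpa using hmem

theorem PadicInt.not_two_dvd_one : ¬ (2 : ℤ_[2]) ∣ 1 := by
  have := PadicInt.norm_lt_one_iff_dvd (p := 2) 1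
  simpa using this

theorem two_mul_padicHalf {x : ℤ_[2]} (h : (2 : ℤ_[2]) ∣ x) : 2 * padicHalf x = x := by
  have h' : ∃ c : ℤ_[2], x = 2 * c := h
  rw [padicHalf, dif_pos h', ← h'.choose_spec]

theorem two_mul_padicT_of_dvd {α : ℤ_[2]} (h : (2 : ℤ_[2]) ∣ α) : 2 * padicT α = α := by
  rw [padicT, if_pos h, two_mul_padicHalf h]

theorem two_mul_padicT_of_not_dvd {α : ℤ_[2]} (h : ¬ (2 : ℤ_[2]) ∣ α) :
    2 * padicT α = 3 * α + 1 := by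
  rw [padicT, if_neg h, two_mul_padicHalf]
  obtain ⟨c, hc⟩ := PadicInt.two_dvd_sub_one h
  exact ⟨3 * c + 2, by linear_combination 3 * hc⟩

theorem summable_Qinf (α : ℤ_[2]) : Summable fun i : ℕ =>
    (if (2 : ℤ_[2]) ∣ padicT^[i] α then (0 : ℤ_[2]) else 1) * 2 ^ i := by
  refine .of_norm_bounded (summable_geometric_of_lt_one (r := (2 : ℝ)⁻¹) (by norm_num)
    (by norm_num)) fun i => ?_
  have h2 : ‖(2 : ℤ_[2])‖ = 2⁻¹ := by simpa using PadicInt.norm_p (p := 2)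
  split_ifs
  · simp
  · simp [h2]

theorem Qinf_eq (α : ℤ_[2]) :
    Qinf α = (if (2 : ℤ_[2]) ∣ α then 0 else 1) + 2 * Qinf (padicT α) := by
  rw [Qinf, (summable_Qinf α).tsum_eq_zero_add, Qinf, ← (summable_Qinf (padicT α)).tsum_mul_left]
  simp only [Function.iterate_zero, id_eq, pow_zero, mul_one, Function.iterate_succ_apply]
  congr 2
  funext i
  by_cases h : (2 : ℤ_[2]) ∣ padicT^[i] (padicT α) <;> simp [h, pow_succ']

theorem two_dvd_Qinf_iff (α : ℤ_[2]) : (2 : ℤ_[2]) ∣ Qinf α ↔ (2 : ℤ_[2]) ∣ α := by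
  rw [Qinf_eq, dvd_add_left (dvd_mul_right _ _)]
  split_ifs with h <;> simp [h, PadicInt.not_two_dvd_one]

theorem two_dvd_sub_iff {α β : ℤ_[2]} :
    (2 : ℤ_[2]) ∣ α - β ↔ ((2 : ℤ_[2]) ∣ α ↔ (2 : ℤ_[2]) ∣ β) := by
  refine ⟨fun h => dvd_iff_dvd_of_dvd_sub h, fun h => ?_⟩
  by_cases hα : (2 : ℤ_[2]) ∣ α
  · exact dvd_sub hα (h.1 hα)
  · simpa using dvd_sub (PadicInt.two_dvd_sub_one hα) (PadicInt.two_dvd_sub_one (mt h.2 hα))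

theorem pow_succ_dvd_sub_iff {α β : ℤ_[2]} (h : (2 : ℤ_[2]) ∣ α ↔ (2 : ℤ_[2]) ∣ β) (n : ℕ) :
    (2 : ℤ_[2]) ^ (n + 1) ∣ α - β ↔ (2 : ℤ_[2]) ^ n ∣ padicT α - padicT β := by
  rw [← mul_dvd_mul_iff_left (b := (2 : ℤ_[2]) ^ n) (two_ne_zero (α := ℤ_[2])), ← pow_succ',
    mul_sub]
  by_cases hα : (2 : ℤ_[2]) ∣ α
  · rw [two_mul_padicT_of_dvd hα, two_mul_padicT_of_dvd (h.1 hα)]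
  · rw [two_mul_padicT_of_not_dvd hα, two_mul_padicT_of_not_dvd (mt h.2 hα),
      add_sub_add_right_eq_sub, ← mul_sub]
    have hcop : IsCoprime ((2 : ℤ_[2]) ^ (n + 1)) 3 := IsCoprime.pow_left ⟨-1, 1, by norm_num⟩
    exact ⟨fun hd => hd.mul_left _, hcop.dvd_of_dvd_mul_left⟩

theorem pow_dvd_Qinf_sub_iff (n : ℕ) (α β : ℤ_[2]) :
    (2 : ℤ_[2]) ^ n ∣ Qinf α - Qinf β ↔ (2 : ℤ_[2]) ^ n ∣ α - β := by
  induction n generalizing α β with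
  | zero => simp
  | succ n ih =>
    by_cases h : (2 : ℤ_[2]) ∣ α ↔ (2 : ℤ_[2]) ∣ β
    · rw [pow_succ_dvd_sub_iff h, ← ih, Qinf_eq α, Qinf_eq β]
      simp only [h]
      rw [add_sub_add_left_eq_sub, ← mul_sub, pow_succ', mul_dvd_mul_iff_left two_ne_zero]
    · have h2 : (2 : ℤ_[2]) ∣ 2 ^ (n + 1) := dvd_pow_self _ n.succ_ne_zero
      refine iff_of_false (fun hd => h ?_) (fun hd => h ?_)
      · simpa only [two_dvd_Qinf_iff] using two_dvd_sub_iff.1 (h2.trans hd)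
      · exact two_dvd_sub_iff.1 (h2.trans hd)

theorem isometry_Qinf : Isometry Qinf := by
  refine Isometry.of_dist_eq fun α β => ?_
  rw [dist_eq_norm, dist_eq_norm]
  apply le_antisymm <;> refine PadicInt.norm_le_of_forall_pow_dvd fun n h => ?_
  · simpa using (pow_dvd_Qinf_sub_iff n α β).2 (by simpa using h)
  · simpa using (pow_dvd_Qinf_sub_iff n α β).1 (by simpa using h)

/-- `Qinf` as an isometric bijection of `ℤ_[2]`. -/
noncomputable def qinfIsometryEquiv : ℤ_[2] ≃ᵢ ℤ_[2] where
  toEquiv := .ofBijective Qinf ⟨isometry_Qinf.injective, isometry_Qinf.surjective_of_compactSpace⟩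
  isometry_toFun := isometry_Qinf

/-- Lagarias (1985, Theorem L): `Q_∞` is a homeomorphism of `ℤ₂` onto itself preserving the
normalized Haar measure. -/
theorem Qinf_homeomorph_measurePreserving
    [MeasurableSpace ℤ_[2]] [BorelSpace ℤ_[2]] :
    (∃ h : ℤ_[2] ≃ₜ ℤ_[2], ⇑h = Qinf) ∧
    ∀ (μ : Measure ℤ_[2]), μ.IsAddHaarMeasure → IsProbabilityMeasure μ →
      MeasurePreserving Qinf μ μ := by
  refine ⟨⟨qinfIsometryEquiv.toHomeomorph, rfl⟩, fun μ _ _ => ?_⟩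
  have : IsUltrametricDist ℤ_[2] :=
    .isUltrametricDist_of_forall_norm_add_le_max_norm PadicInt.nonarchimedean
  refine qinfIsometryEquiv.measurePreserving_of_measure_ball_eq fun x y r => ?_
  rw [← measure_preimage_add μ (x - y) (Metric.ball x r), preimage_add_ball, sub_sub_cancel]
end
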